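/- arXiv:2403.19642 — 2 statements merged into one kernel-verified Lean document; each statement's English description precedes it below -/
import Mathlib

section
/- Let q be an odd prime power, let f ∈ F_q[x] be a dynamically 2-ordinary polynomial of degree d ≥ 2, and let a ∈ F_q be such that the sequence (χ(f^ℓ(a)))_{ℓ≥1} is periodic with period m. Then for every positive integer L, |O_f(a)| ≤ 2L + 1 + m·(q/2^L + d^{L+1}·√q). -/
open Polynomial

/-- The `n`-th iterate of a polynomial under composition, with `f^0 = X`. -/
noncomputable def polyIter {K : Type*} [CommRing K] (f : K[X]) : ℕ → K[X]
  | 0 => X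
  | n + 1 => f.comp (polyIter f n)

/-- `f` is dynamically 2-ordinary: for every `n ≥ 1` there is an irreducible factor of `f^n`
with odd multiplicity in `f^n` that does not divide `f^i` for any `i < n`. -/
def DynTwoOrdinary {K : Type*} [Field K] (f : K[X]) : Prop :=
  ∀ n : ℕ, 1 ≤ n → ∃ g : K[X], Irreducible g ∧
    (∃ e : ℕ, Odd e ∧ g ^ e ∣ polyIter f n ∧ ¬ g ^ (e + 1) ∣ polyIter f n) ∧
    ∀ i : ℕ, i < n → ¬ g ∣ polyIter f i

open Classical in
/-- The quadratic character of a field: `χ(0) = 0`, `χ(x) = 1` if `x` is a nonzero square,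
`χ(x) = −1` otherwise. -/
noncomputable def chi {F : Type*} [Field F] (x : F) : ℤ :=
  if x = 0 then 0 else if IsSquare x then 1 else -1


theorem sp_choose_zero {F : Type} [Field F] [Fintype F] (j k : ℕ) (hk0 : 0 < k)
    (hk : k < Fintype.card F) : (((Fintype.card F * j).choose k : ℕ) : F) = 0 := by
  have h1 : ((X + 1 : F[X]) ^ (Fintype.card F * j)).coeff k = 0 := by
    rw [mul_comm, pow_mul, ← FiniteField.expand_card, coeff_expand Fintype.card_pos, if_neg]
    intro h
    exact absurd (Nat.le_of_dvd hk0 h) (by omega)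
  rwa [coeff_X_add_one_pow] at h1

theorem sp_hasse_X {F : Type} [Field F] [Fintype F] (j k : ℕ) (hk0 : 0 < k)
    (hk : k < Fintype.card F) : hasseDeriv k (X ^ (Fintype.card F * j) : F[X]) = 0 := by
  rw [X_pow_eq_monomial, hasseDeriv_monomial, sp_choose_zero j k hk0 hk]
  simp

theorem sp_hasse_mul_X {F : Type} [Field F] [Fintype F] (p : F[X]) (j k : ℕ)
    (hk : k < Fintype.card F) : hasseDeriv k (p * X ^ (Fintype.card F * j) : F[X]) =
      hasseDeriv k p * X ^ (Fintype.card F * j) := by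
  rw [hasseDeriv_mul, Finset.sum_eq_single (k, 0)]
  · simp
  · rintro ⟨a, b⟩ hab hne
    rw [Finset.HasAntidiagonal.mem_antidiagonal] at hab
    simp only at hab ⊢
    rw [sp_hasse_X j b, mul_zero]
    · rcases Nat.eq_zero_or_pos b with h | h
      · subst h; exact absurd (by simpa using hab) hne
      · exact h
    · omega
  · intro h; exact absurd (by simp) h

theorem sp_deg_hasse {F : Type} [Field F] (g p : F[X]) (B a : ℕ) (hg : 1 ≤ g.natDegree)
    (hp : p.natDegree ≤ B) : (g ^ a * hasseDeriv a p).natDegree ≤ B + a * (g.natDegree - 1) := by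
  rcases Nat.lt_or_ge p.natDegree a with h | h
  · rw [hasseDeriv_eq_zero_of_lt_natDegree _ _ h]; simp
  · refine natDegree_mul_le.trans ?_
    have h1 := natDegree_hasseDeriv_le p a
    have h2 : (g ^ a).natDegree ≤ a * g.natDegree := natDegree_pow_le
    have h3 : a * g.natDegree = a * (g.natDegree - 1) + a := by
      obtain ⟨D, hD⟩ : ∃ D, g.natDegree = D + 1 := ⟨g.natDegree - 1, by omega⟩
      rw [hD]; simp; ring
    omega

theorem sp_W {F : Type} [Field F] (g : F[X]) (hg : 1 ≤ g.natDegree) (n : ℕ) :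
    ∃ W : ℕ → F[X], ∀ k, (W k).natDegree ≤ k * (g.natDegree - 1) ∧
      g ^ k * hasseDeriv k (g ^ n) = g ^ n * W k := by
  induction n with
  | zero =>
    refine ⟨fun k => if k = 0 then 1 else 0, fun k => ?_⟩
    rcases Nat.eq_zero_or_pos k with h | h
    · subst h; simp
    · have : k ≠ 0 := by omega
      simp [this, hasseDeriv_apply_one k h]
  | succ n ih =>
    obtain ⟨W, hW⟩ := ih
    refine ⟨fun k => ∑ x ∈ Finset.HasAntidiagonal.antidiagonal k, W x.1 *
      (if x.2 = 0 then 1 else g ^ (x.2 - 1) * hasseDeriv x.2 g), fun k => ⟨?_, ?_⟩⟩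
    · refine natDegree_sum_le_of_forall_le _ _ ?_
      rintro ⟨a, b⟩ hab
      rw [Finset.HasAntidiagonal.mem_antidiagonal] at hab
      simp only at hab ⊢
      refine natDegree_mul_le.trans ?_
      have h1 := (hW a).1
      rw [← hab, add_mul]
      refine Nat.add_le_add h1 ?_
      split_ifs with hb
      · simp
      · rcases Nat.lt_or_ge g.natDegree b with h | h
        · rw [hasseDeriv_eq_zero_of_lt_natDegree _ _ h]; simp
        · refine natDegree_mul_le.trans ?_
          have h1 := natDegree_hasseDeriv_le g b
          have h2 : (g ^ (b-1)).natDegree ≤ (b-1) * g.natDegree := natDegree_pow_le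
          obtain ⟨D, hD⟩ : ∃ D, g.natDegree = D + 1 := ⟨g.natDegree - 1, by omega⟩
          obtain ⟨c, hc⟩ : ∃ c, b = c + 1 := ⟨b - 1, by omega⟩
          subst hc
          rw [hD] at h1 h2 h ⊢
          simp only [Nat.add_sub_cancel] at h1 h2 ⊢
          have : (c+1) * D + c= c * (D+1) + D := by ring
          omega
    · rw [pow_succ g n, hasseDeriv_mul, Finset.mul_sum, Finset.mul_sum]
      refine Finset.sum_congr rfl ?_
      rintro ⟨a, b⟩ hab
      rw [Finset.HasAntidiagonal.mem_antidiagonal] at hab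
      simp only at hab ⊢
      rw [← hab]
      have h2 := (hW a).2
      split_ifs with hb
      · subst hb
        simp only [add_zero, hasseDeriv_zero', mul_one]
        linear_combination g * h2
      · obtain ⟨c, hc⟩ : ∃ c, b = c + 1 := ⟨b - 1, by omega⟩
        subst hc
        simp only [Nat.add_sub_cancel]
        rw [pow_add]
        linear_combination (g ^ (c+1) * hasseDeriv (c+1) g) * h2

/-- uniqueness of base `X^q` expansions -/
theorem sp_uniq {F : Type} [Field F] (q : ℕ) : ∀ (n : ℕ) (T : F[X][X]), T.natDegree ≤ n →
    (∀ i, (T.coeff i).natDegree < q) → T.eval (X ^ q) = 0 → T = 0 := by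
  have key : ∀ T : F[X][X], (∀ i, (T.coeff i).natDegree < q) → T.eval (X ^ q) = 0 →
      T.coeff 0 = 0 ∧ (T.divX).eval (X ^ q) = 0 := by
    intro T hT h0
    have h1 : (T.divX).eval (X ^ q) * X ^ q + T.coeff 0 = 0 := by
      rw [← h0]; nth_rewrite 3 [← divX_mul_X_add T]; simp
    have h2 : T.coeff 0 = 0 := by
      by_contra hne
      have : (X ^ q : F[X]) ∣ T.coeff 0 := ⟨-(T.divX).eval (X ^ q), by linear_combination h1⟩
      have := natDegree_le_of_dvd this hne
      rw [natDegree_X_pow] at this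
      have := hT 0
      omega
    refine ⟨h2, ?_⟩
    rw [h2, add_zero] at h1
    rcases mul_eq_zero.1 h1 with h | h
    · exact h
    · exact absurd h (pow_ne_zero _ X_ne_zero)
  intro n
  induction n with
  | zero =>
    intro T hd hT h0
    rw [eq_C_of_natDegree_le_zero hd, (key T hT h0).1, C_0]
  | succ n ih =>
    intro T hd hT h0
    obtain ⟨h1, h2⟩ := key T hT h0
    have : T.divX = 0 := by
      refine ih _ ?_ ?_ h2
      · rw [natDegree_divX_eq_natDegree_tsub_one]; omega
      · intro i; rw [coeff_divX]; exact hT _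
    rw [← divX_mul_X_add T, this, h1]; simp

theorem sp_square {F : Type} [Field F] (g π : F[X]) (hπ : Irreducible π) (e : ℕ)
    (he : Odd e) (h1 : π ^ e ∣ g) (h2 : ¬ π ^ (e+1) ∣ g) (P Q : F[X][X])
    (h : C g * P ^ 2 = g.map C * Q ^ 2) : P = 0 ∧ Q = 0 := by
  have hg0 : g ≠ 0 := by rintro rfl; exact h2 (dvd_zero _)
  have hmg : g.map (C : F →+* F[X]) ≠ 0 := by
    rwa [Ne, Polynomial.map_eq_zero_iff C_injective]
  have hCg : (C g : F[X][X]) ≠ 0 := by rwa [Ne, C_eq_zero]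
  have hpr : Prime (C π : F[X][X]) := prime_C_iff.2 hπ.prime
  by_cases hQ : Q = 0
  · refine ⟨?_, hQ⟩
    rw [hQ] at h
    simp only [ne_eq, OfNat.ofNat_ne_zero, not_false_eq_true, zero_pow, mul_zero, mul_eq_zero, hCg,
      pow_eq_zero_iff, false_or] at h
    exact h
  exfalso
  by_cases hP : P = 0
  · rw [hP] at h
    simp [hmg, hQ] at h
  have hnd : ¬ (C π : F[X][X]) ∣ g.map C := by
    rw [C_dvd_iff_dvd_coeff]
    intro hh
    apply hg0
    ext i
    have := hh i
    rw [coeff_map] at this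
    by_contra hne
    have hu : IsUnit (C (g.coeff i)) := isUnit_C.2 (isUnit_iff_ne_zero.2 (by simpa using hne))
    exact hπ.not_isUnit (isUnit_of_dvd_unit this hu)
  have m1 : emultiplicity (C π : F[X][X]) (C g) = e := by
    rw [emultiplicity_eq_coe]
    refine ⟨by rw [← C_pow]; exact map_dvd C h1, fun hh => h2 ?_⟩
    rw [← C_pow, C_dvd_iff_dvd_coeff] at hh
    simpa using hh 0
  have fP : FiniteMultiplicity (C π : F[X][X]) P := FiniteMultiplicity.of_prime_left hpr hP
  have fQ : FiniteMultiplicity (C π : F[X][X]) Q := FiniteMultiplicity.of_prime_left hpr hQ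
  have := congrArg (emultiplicity (C π : F[X][X])) h
  rw [emultiplicity_mul hpr, emultiplicity_mul hpr, m1, emultiplicity_pow hpr, emultiplicity_pow hpr,
    emultiplicity_eq_zero.2 hnd, fP.emultiplicity_eq_multiplicity, fQ.emultiplicity_eq_multiplicity] at this
  norm_cast at this
  obtain ⟨t, rfl⟩ := he
  omega

theorem sp_nonvanish {F : Type} [Field F] [Fintype F] (hq : Odd (Fintype.card F))
    (g π : F[X]) (hπ : Irreducible π) (e : ℕ)
    (he : Odd e) (h1 : π ^ e ∣ g) (h2 : ¬ π ^ (e+1) ∣ g) (P Q : F[X][X]) (B : ℕ)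
    (hP : ∀ i, (P.coeff i).natDegree ≤ B) (hQ : ∀ i, (Q.coeff i).natDegree ≤ B)
    (hB : 2 * B + g.natDegree < Fintype.card F)
    (h : P.eval (X ^ Fintype.card F) + g ^ (Fintype.card F / 2) * Q.eval (X ^ Fintype.card F) = 0) :
    P = 0 ∧ Q = 0 := by
  apply sp_square g π hπ e he h1 h2
  rw [← sub_eq_zero]
  have hsq : ∀ P : F[X][X], (∀ i, (P.coeff i).natDegree ≤ B) →
      ∀ i, ((P ^ 2).coeff i).natDegree ≤ 2 * B := by
    intro P hP i
    rw [sq, coeff_mul]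
    refine natDegree_sum_le_of_forall_le _ _ fun x _ => natDegree_mul_le.trans ?_
    have := hP x.1
    have := hP x.2
    omega
  refine sp_uniq (Fintype.card F) _ _ le_rfl (fun i => ?_) ?_
  · rw [coeff_sub]
    refine (natDegree_sub_le _ _).trans_lt (max_lt ?_ ?_)
    · rw [coeff_C_mul]
      refine natDegree_mul_le.trans_lt ?_
      have := hsq P hP i
      omega
    · rw [coeff_mul]
      refine (natDegree_sum_le_of_forall_le (n := 2 * B) _ _ fun x _ => natDegree_mul_le.trans ?_).trans_lt
        (by omega)
      rw [coeff_map, natDegree_C, zero_add]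
      exact hsq Q hQ _
  · have hx : (g.map C).eval (X ^ Fintype.card F : F[X]) = g ^ Fintype.card F := by
      rw [eval_map, ← comp, ← expand_eq_comp_X_pow, FiniteField.expand_card]
    simp only [eval_sub, eval_mul, eval_pow, eval_C, hx]
    have hh : g ^ Fintype.card F = g * (g ^ (Fintype.card F / 2)) ^ 2 := by
      rw [← pow_mul, ← pow_succ']
      congr 1
      obtain ⟨t, ht⟩ := hq
      omega
    rw [hh]
    linear_combination (g * (P.eval (X ^ Fintype.card F) - g ^ (Fintype.card F / 2) * Q.eval (X ^ Fintype.card F))) * h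

theorem sp_memLT {F : Type} [Field F] (p : F[X]) (n : ℕ) :
    p ∈ degreeLT F (n + 1) ↔ p.natDegree ≤ n := by
  rw [mem_degreeLT, degree_lt_iff_coeff_zero, natDegree_le_iff_coeff_eq_zero]
  exact Iff.rfl

theorem sp_finrank {F : Type} [Field F] (n : ℕ) : Module.finrank F (degreeLT F n) = n := by
  rw [(degreeLTEquiv F n).finrank_eq]; simp

instance sp_fd {F : Type} [Field F] (n : ℕ) : FiniteDimensional F (degreeLT F n) :=
  Module.Finite.equiv (degreeLTEquiv F n).symm

/-- the linear conditions -/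
noncomputable def spPhi {F : Type} [Field F] (g : F[X]) (W : ℕ → F[X]) (B J1 J2 k : ℕ) :
    ((Fin J1 → degreeLT F B) × (Fin J2 → degreeLT F B)) →ₗ[F] F[X] where
  toFun u := ∑ j, g ^ k * hasseDeriv k (u.1 j : F[X]) * X ^ (j : ℕ) +
    ∑ j, (∑ x ∈ Finset.HasAntidiagonal.antidiagonal k,
      g ^ x.1 * hasseDeriv x.1 (u.2 j : F[X]) * W x.2) * X ^ (j : ℕ)
  map_add' u v := by
    simp only [Prod.fst_add, Prod.snd_add, Pi.add_apply, Submodule.coe_add, map_add, mul_add,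
      add_mul, Finset.sum_add_distrib]
    abel
  map_smul' c u := by
    simp only [Prod.smul_fst, Prod.smul_snd, Pi.smul_apply, Submodule.coe_smul, map_smul,
      Algebra.mul_smul_comm, Algebra.smul_mul_assoc, RingHom.id_apply, Finset.smul_sum, smul_add, Finset.sum_mul]

set_option maxHeartbeats 2000000 in
theorem sp_main {F : Type} [Field F] [Fintype F] [DecidableEq F] (hq : Odd (Fintype.card F))
    (g π : F[X]) (hπ : Irreducible π) (e : ℕ)
    (he : Odd e) (h1 : π ^ e ∣ g) (h2 : ¬ π ^ (e+1) ∣ g) (B K E M : ℕ)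
    (hg : 1 ≤ g.natDegree) (hB : 2 * B + g.natDegree < Fintype.card F)
    (hE : 2 * E ≤ g.natDegree) (hM : M ≤ Fintype.card F)
    (hc : ∑ k ∈ Finset.range M, (B + K + E + k * (g.natDegree - 1) + 1) <
      (B + 1) * (2 * K + 2 + E)) :
    2 * (M * (Finset.univ.filter fun x : F => (g.eval x) ^ (Fintype.card F / 2) = 1).card) ≤
      2 * B + Fintype.card F * g.natDegree + 2 * (Fintype.card F * K) := by
  set q := Fintype.card F with hqdef
  obtain ⟨W, hW⟩ := sp_W g hg (q / 2)
  have hmem : ∀ k u, spPhi g W (B+1) (K+1+E) (K+1) k u ∈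
      degreeLT F (B + K + E + k * (g.natDegree - 1) + 1) := by
    intro k u
    rw [sp_memLT]
    have hu1 : ∀ j, (u.1 j : F[X]).natDegree ≤ B := fun j => (sp_memLT _ _).1 (u.1 j).2
    have hu2 : ∀ j, (u.2 j : F[X]).natDegree ≤ B := fun j => (sp_memLT _ _).1 (u.2 j).2
    refine natDegree_add_le_of_degree_le ?_ ?_
    · refine natDegree_sum_le_of_forall_le _ _ fun j _ => natDegree_mul_le.trans ?_
      have := sp_deg_hasse g _ B k hg (hu1 j)
      rw [natDegree_X_pow]
      have := j.2
      omega
    · refine natDegree_sum_le_of_forall_le _ _ fun j _ => natDegree_mul_le.trans ?_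
      rw [natDegree_X_pow]
      have hj := j.2
      have : (∑ x ∈ Finset.HasAntidiagonal.antidiagonal k,
          g ^ x.1 * hasseDeriv x.1 (u.2 j : F[X]) * W x.2).natDegree
          ≤ B + k * (g.natDegree - 1) := by
        refine natDegree_sum_le_of_forall_le _ _ fun x hx => natDegree_mul_le.trans ?_
        rw [Finset.HasAntidiagonal.mem_antidiagonal] at hx
        have a1 := sp_deg_hasse g _ B x.1 hg (hu2 j)
        have a2 := (hW x.2).1
        rw [← hx, add_mul]
        omega
      omega
  let Φ : ((Fin (K+1+E) → degreeLT F (B+1)) × (Fin (K+1) → degreeLT F (B+1))) →ₗ[F]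
      ((k : Fin M) → degreeLT F (B + K + E + (k : ℕ) * (g.natDegree - 1) + 1)) :=
    LinearMap.pi fun k => LinearMap.codRestrict _ (spPhi g W (B+1) (K+1+E) (K+1) k) (hmem k)
  have hker : LinearMap.ker Φ ≠ ⊥ := by
    apply LinearMap.ker_ne_bot_of_finrank_lt
    rw [Module.finrank_prod, Module.finrank_pi_fintype, Module.finrank_pi_fintype,
      Module.finrank_pi_fintype]
    simp only [sp_finrank]
    rw [Fin.sum_univ_eq_sum_range (fun k => B + K + E + k * (g.natDegree - 1) + 1)]
    refine hc.trans_le (le_of_eq ?_)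
    simp
    ring
  obtain ⟨u, hu, hu0⟩ := (Submodule.ne_bot_iff _).1 hker
  rw [LinearMap.mem_ker] at hu
  have hu' : ∀ k, k < M → spPhi g W (B+1) (K+1+E) (K+1) k u = 0 := by
    intro k hk
    have := congrArg Subtype.val (congrFun hu ⟨k, hk⟩)
    simpa [Φ] using this
  have hu1 : ∀ j, (u.1 j : F[X]).natDegree ≤ B := fun j => (sp_memLT _ _).1 (u.1 j).2
  have hu2 : ∀ j, (u.2 j : F[X]).natDegree ≤ B := fun j => (sp_memLT _ _).1 (u.2 j).2
  set R : F[X] := ∑ j, (u.1 j : F[X]) * X ^ (q * (j:ℕ)) +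
    ∑ j, ((u.2 j : F[X]) * g ^ (q/2)) * X ^ (q * (j:ℕ)) with hR
  have hcoef : ∀ (J : ℕ) (v : Fin J → F[X]) (i : ℕ),
      (∑ j, C (v j) * X ^ (j : ℕ) : F[X][X]).coeff i = if h : i < J then v ⟨i, h⟩ else 0 := by
    intro J v i
    rw [finsetSum_coeff]
    simp only [coeff_C_mul, coeff_X_pow, mul_ite, mul_one, mul_zero]
    split_ifs with h
    · rw [Finset.sum_eq_single ⟨i, h⟩]
      · simp
      · intro b _ hb
        rw [if_neg]
        rintro rfl
        exact hb rfl
      · simp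
    · refine Finset.sum_eq_zero fun j _ => if_neg ?_
      have := j.2
      omega
  have hR0 : R ≠ 0 := by
    intro hR0
    apply hu0
    have := sp_nonvanish hq g π hπ e he h1 h2 (∑ j, C (u.1 j : F[X]) * X ^ (j : ℕ))
      (∑ j, C (u.2 j : F[X]) * X ^ (j : ℕ)) B ?_ ?_ hB ?_
    · obtain ⟨a1, a2⟩ := this
      refine Prod.ext (funext fun j => Subtype.ext ?_) (funext fun j => Subtype.ext ?_)
      · have := congrArg (fun t => coeff t (j : ℕ)) a1
        simpa [hcoef _ (fun j => (u.1 j : F[X]))] using this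
      · have := congrArg (fun t => coeff t (j : ℕ)) a2
        rw [hcoef _ (fun j => (u.2 j : F[X])), dif_pos j.2] at this
        simpa using this
    · intro i
      rw [hcoef _ (fun j => (u.1 j : F[X]))]
      split_ifs
      · exact hu1 _
      · simp
    · intro i
      rw [hcoef _ (fun j => (u.2 j : F[X]))]
      split_ifs
      · exact hu2 _
      · simp
    · rw [← hR0, hR]
      simp only [eval_finsetSum, eval_mul, eval_C, eval_pow, eval_X, ← pow_mul, Finset.mul_sum]
      congr 1
      refine Finset.sum_congr rfl fun j _ => ?_
      ring
  have hdeg : 2 * R.natDegree ≤ 2 * B + q * g.natDegree + 2 * (q * K) := by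
    have : R.natDegree ≤ max (B + q * (K + E)) (B + (q / 2) * g.natDegree + q * K) := by
      rw [hR]
      refine (natDegree_add_le _ _).trans (max_le_max ?_ ?_)
      · refine natDegree_sum_le_of_forall_le _ _ fun j _ => natDegree_mul_le.trans ?_
        rw [natDegree_X_pow]
        exact Nat.add_le_add (hu1 j) (Nat.mul_le_mul_left _ (by have := j.2; omega))
      · refine natDegree_sum_le_of_forall_le _ _ fun j _ => natDegree_mul_le.trans ?_
        rw [natDegree_X_pow]
        refine Nat.add_le_add (natDegree_mul_le.trans (Nat.add_le_add (hu2 j) natDegree_pow_le))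
          (Nat.mul_le_mul_left _ (by have := j.2; omega))
    rcases le_max_iff.1 this with h | h
    · have : q * (2 * E) ≤ q * g.natDegree := Nat.mul_le_mul_left _ hE
      nlinarith
    · have : 2 * (q / 2) ≤ q := by omega
      have := Nat.mul_le_mul_right g.natDegree this
      nlinarith
  have hvan : ∀ x : F, (g.eval x) ^ (q / 2) = 1 → (X - C x) ^ M ∣ R := by
    intro x hx
    have hgx : g.eval x ≠ 0 := by
      intro h0
      rw [h0, zero_pow] at hx
      · exact zero_ne_one hx
      · have : 1 < q := Fintype.one_lt_card
        omega
    have hder : ∀ k < M, (hasseDeriv k R).eval x = 0 := by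
      intro k hk
      have hkq : k < q := by omega
      have e1 : g ^ k * hasseDeriv k R = ∑ j, g ^ k * hasseDeriv k (u.1 j : F[X]) * X ^ (q * (j:ℕ)) +
          g ^ (q/2) * ∑ j, (∑ x ∈ Finset.HasAntidiagonal.antidiagonal k,
      g ^ x.1 * hasseDeriv x.1 (u.2 j : F[X]) * W x.2) * X ^ (q * (j:ℕ)) := by
        rw [hR, map_add, map_sum, map_sum, mul_add, Finset.mul_sum, Finset.mul_sum, Finset.mul_sum]
        congr 1
        · refine Finset.sum_congr rfl fun j _ => ?_
          rw [sp_hasse_mul_X _ _ _ hkq, mul_assoc]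
        · refine Finset.sum_congr rfl fun j _ => ?_
          rw [sp_hasse_mul_X _ _ _ hkq, ← mul_assoc, ← mul_assoc]
          congr 1
          rw [hasseDeriv_mul, Finset.mul_sum, Finset.mul_sum]
          refine Finset.sum_congr rfl fun y hy => ?_
          rw [Finset.HasAntidiagonal.mem_antidiagonal] at hy
          have := (hW y.2).2
          rw [← hy, pow_add]
          linear_combination (g ^ y.1 * hasseDeriv y.1 (u.2 j : F[X])) * this
      have e2 : (g ^ k * hasseDeriv k R).eval x = (spPhi g W (B+1) (K+1+E) (K+1) k u).eval x := by
        have hpw : ∀ j : ℕ, x ^ (q * j) = x ^ j := fun j => by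
          rw [pow_mul, hqdef, FiniteField.pow_card]
        rw [e1]
        simp only [spPhi, LinearMap.coe_mk, AddHom.coe_mk, eval_add, eval_mul, eval_pow,
          eval_finsetSum, eval_X, hx, one_mul, hpw]
      rw [hu' k hk, eval_zero, eval_mul, eval_pow] at e2
      exact (mul_eq_zero.1 e2).resolve_left (pow_ne_zero _ hgx)
    have : X ^ M ∣ taylor x R := by
      rw [X_pow_dvd_iff]
      intro k hk
      rw [taylor_coeff, hder k hk]
    obtain ⟨S, hS⟩ := this
    refine ⟨taylor (-x) S, ?_⟩
    have := congrArg (taylor (-x)) hS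
    rw [taylor_taylor, taylor_mul, taylor_X_pow] at this
    simpa [sub_eq_add_neg] using this
  have hprod : ∏ x ∈ Finset.univ.filter (fun x : F => (g.eval x) ^ (q / 2) = 1), (X - C x) ^ M ∣ R := by
    apply Finset.prod_dvd_of_coprime
    · intro a _ b _ hab
      exact (isCoprime_X_sub_C_of_isUnit_sub (sub_ne_zero.2 hab).isUnit).pow
    · intro x hx
      exact hvan x (Finset.mem_filter.1 hx).2
  have := natDegree_le_of_dvd hprod hR0
  rw [natDegree_prod _ _ (fun x _ => pow_ne_zero _ (X_sub_C_ne_zero x))] at this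
  simp only [natDegree_pow, natDegree_X_sub_C, mul_one, Finset.sum_const, smul_eq_mul] at this
  rw [mul_comm M]
  omega

theorem sp_num (q D E M B K Z : ℕ) (s : ℝ) (hs : s ^ 2 = q) (hMs : (M : ℝ) ≤ s) (hsM : s ≤ M + 1)
    (hM : 8 ≤ M) (hD : 1 ≤ D) (hDM : D + 2 ≤ M) (hE : D ≤ 2 * E + 1) (hE2 : 2 * E ≤ D)
    (hB : q ≤ 2 * B + D + 2) (hB2 : 2 * B + D + 1 ≤ q)
    (hK : (K : ℝ) * (2 * B + 2 - M) ≤ (2 * B + 2 - M) + (M * (B + E + 1) + (D - 1) * M * (M - 1) / 2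
       - (B + 1) * (2 + E)))
    (hZ : 2 * (M * Z) ≤ 2 * B + q * D + 2 * (q * K)) :
    2 * (Z : ℝ) + D ≤ q + 2 * (D + 1) * s := by
  have hM' : (8 : ℝ) ≤ M := by exact_mod_cast hM
  have hD' : (1 : ℝ) ≤ D := by exact_mod_cast hD
  have hDM' : (D : ℝ) + 2 ≤ M := by exact_mod_cast hDM
  have hE' : (D : ℝ) ≤ 2 * E + 1 := by exact_mod_cast hE
  have hE2' : 2 * (E : ℝ) ≤ D := by exact_mod_cast hE2
  have hB' : (q : ℝ) ≤ 2 * B + D + 2 := by exact_mod_cast hB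
  have hB2' : 2 * (B : ℝ) + D + 1 ≤ q := by exact_mod_cast hB2
  have hZ' : 2 * ((M : ℝ) * Z) ≤ 2 * B + q * D + 2 * (q * K) := by exact_mod_cast hZ
  clear hB hB2 hZ hE hE2 hDM hD hM
  generalize (M : ℝ) = m at *
  generalize (D : ℝ) = d at *
  generalize (E : ℝ) = e at *
  generalize (B : ℝ) = b at *
  generalize (K : ℝ) = k at *
  generalize (Z : ℝ) = z at *
  generalize (q : ℝ) = Q at *
  obtain ⟨A, hA⟩ : ∃ A, A = 2 * b + 2 - m := ⟨_, rfl⟩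
  have hbA : b = (A + m - 2) / 2 := by linarith
  have hqm : m ^ 2 ≤ Q := by nlinarith
  have hAq : 25 * Q ≤ 32 * A := by nlinarith [mul_nonneg (sub_nonneg.2 hM') (by linarith : (0:ℝ) ≤ 7 * m - 8)]
  have hQ0 : 0 < Q := by nlinarith
  have hA0 : 0 < A := by linarith
  rw [← hA] at hK
  have hmA : 0 < m * A := by positivity
  refine le_of_mul_le_mul_left ?_ hmA
  have hK2 : 2 * (k * A) ≤ 2 * A + (A * (m - 2 - e) + m * (d * m - d - 1 + e)) := by
    rw [hbA] at hK; nlinarith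
  have key : A * Q * (d + 1 - e) + Q * m * (d * m - d - 1 + e) ≤ m * A * (2 * (d + 1) * s - d) := by
    have t1 : A * Q * (d + 1 - e) ≤ A * Q * ((d + 3) / 2) :=
      mul_le_mul_of_nonneg_left (by linarith) (by positivity)
    have t2 : Q * m * (d * m - d - 1 + e) ≤ (32 / 25 * A) * m * (d * m - d / 2 - 1) := by
      have : d * m - d - 1 + e ≤ d * m - d / 2 - 1 := by linarith
      have h0 : 0 ≤ d * m - d / 2 - 1 := by nlinarith
      have h1 : Q * m ≤ (32 / 25 * A) * m := mul_le_mul_of_nonneg_right (by linarith) (by linarith)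
      calc _ ≤ Q * m * (d * m - d / 2 - 1) := mul_le_mul_of_nonneg_left this (by positivity)
        _ ≤ _ := mul_le_mul_of_nonneg_right h1 h0
    have t3 : Q ≤ 9 / 8 * (m * s) := by rw [← hs]; nlinarith
    have t4 : A * Q * ((d + 3) / 2) ≤ A * (9 / 8 * (m * s)) * ((d + 3) / 2) := by gcongr
    have t5 : 9 / 8 * s * ((d + 3) / 2) + 32 / 25 * (d * m - d / 2 - 1) ≤ 2 * (d + 1) * s - d := by
      have : d * m ≤ d * s := mul_le_mul_of_nonneg_left hMs (by linarith)
      have : d * 8 ≤ d * s := mul_le_mul_of_nonneg_left (by linarith) (by linarith)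
      nlinarith
    have := mul_le_mul_of_nonneg_left t5 hmA.le
    nlinarith
  have f1 : A * (2 * (m * z)) ≤ A * (2 * b + Q * d + 2 * (Q * k)) :=
    mul_le_mul_of_nonneg_left hZ' hA0.le
  have f2 := mul_le_mul_of_nonneg_left hK2 hQ0.le
  have f3 : A * (2 * b) ≤ A * (Q - d - 1) := mul_le_mul_of_nonneg_left (by linarith) hA0.le
  have f4 : 0 ≤ A * (d + 1) := by positivity
  nlinarith

theorem sp_count {F : Type} [Field F] [Fintype F] [DecidableEq F] (hq : Odd (Fintype.card F))
    (g π : F[X]) (hπ : Irreducible π) (e : ℕ)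
    (he : Odd e) (h1 : π ^ e ∣ g) (h2 : ¬ π ^ (e+1) ∣ g)
    (hg : 1 ≤ g.natDegree) (hM : 64 ≤ Fintype.card F)
    (hD : (g.natDegree + 2) ^ 2 ≤ Fintype.card F) :
    2 * ((Finset.univ.filter fun x : F => (g.eval x) ^ (Fintype.card F / 2) = 1).card : ℝ)
      + g.natDegree ≤ Fintype.card F + 2 * (g.natDegree + 1) * Real.sqrt (Fintype.card F) := by
  set q := Fintype.card F with hqdef
  set D := g.natDegree with hDdef
  set M := Nat.sqrt q with hMdef
  have hM8 : 8 ≤ M := Nat.le_sqrt'.2 hM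
  have hDM : D + 2 ≤ M := Nat.le_sqrt'.2 hD
  have hMq : M * M ≤ q := Nat.sqrt_le q
  have hMq' : M ≤ q := by nlinarith
  have hqM : q < (M + 1) * (M + 1) := Nat.lt_succ_sqrt q
  obtain ⟨B, hB⟩ : ∃ B, B = (q - D - 1) / 2 := ⟨_, rfl⟩
  obtain ⟨E, hE⟩ : ∃ E, E = D / 2 := ⟨_, rfl⟩
  have hqD : 8 * M ≤ q := by nlinarith
  have hB1 : q ≤ 2 * B + D + 2 := by omega
  have hB2 : 2 * B + D + 1 ≤ q := by omega
  obtain ⟨A, hA⟩ : ∃ A, A + M = 2 * B + 2 := ⟨2 * B + 2 - M, by omega⟩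
  have hA0 : 0 < A := by omega
  obtain ⟨G, hG⟩ : ∃ G, G = ∑ k ∈ Finset.range M, k * (D - 1) := ⟨_, rfl⟩
  have hUV : (B + 1) * (2 + E) ≤ M * (B + E + 1) + G := by
    have : (B + 1) * (2 + E) ≤ (B + 1) * M := Nat.mul_le_mul_left _ (by omega)
    nlinarith
  obtain ⟨Y, hY⟩ : ∃ Y, (B + 1) * (2 + E) + Y = M * (B + E + 1) + G :=
    ⟨M * (B + E + 1) + G - (B + 1) * (2 + E), by omega⟩
  obtain ⟨K, hK⟩ : ∃ K, K = Y / A + 1 := ⟨_, rfl⟩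
  have hK1 : Y < K * A := by
    rw [hK, mul_comm]; exact Nat.lt_mul_div_succ Y hA0
  have hK2 : K * A ≤ A + Y := by
    rw [hK, add_mul, one_mul, add_comm]
    exact Nat.add_le_add_left (Nat.div_mul_le_self _ _) _
  have hG' : (G : ℝ) = (D - 1) * M * (M - 1) / 2 := by
    have hD1 : ((D - 1 : ℕ) : ℝ) = D - 1 := by rw [Nat.cast_sub hg]; simp
    have : ∀ M : ℕ, ((∑ k ∈ Finset.range M, k * (D - 1) : ℕ) : ℝ) = (D - 1) * M * (M - 1) / 2 := by
      intro M
      induction M with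
      | zero => simp
      | succ n ih =>
        rw [Finset.sum_range_succ, Nat.cast_add, ih, Nat.cast_mul, hD1]
        push_cast
        ring
    rw [hG, this]
  have hY' : ((B : ℝ) + 1) * (2 + E) + Y = M * (B + E + 1) + G := by exact_mod_cast hY
  have hA' : (A : ℝ) = 2 * B + 2 - M := by
    have : (A : ℝ) + M = 2 * B + 2 := by exact_mod_cast hA
    linarith
  have hK2' : (K : ℝ) * A ≤ A + Y := by exact_mod_cast hK2
  refine sp_num q D E M B K _ (Real.sqrt q) (Real.sq_sqrt (Nat.cast_nonneg _)) ?_ ?_ hM8 hg hDM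
    (by omega) (by omega) hB1 hB2 ?_ (sp_main hq g π hπ e he h1 h2 B K E M hg (by omega) (by omega) hMq' ?_)
  · exact Real.nat_sqrt_le_real_sqrt
  · exact Real.real_sqrt_le_nat_sqrt_succ
  · rw [← hA', ← hG']
    linarith
  · have : ∑ k ∈ Finset.range M, (B + K + E + k * (g.natDegree - 1) + 1) =
        M * (B + K + E + 1) + G := by
      rw [hG]
      simp only [Finset.sum_add_distrib, Finset.sum_const, Finset.card_range, smul_eq_mul]
      ring
    rw [this]
    have hKA : K * (A + M) = K * (2 * B + 2) := by rw [hA]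
    clear this
    linarith

theorem sp_sum_le {F : Type} [Field F] [Fintype F] [DecidableEq F] (hq : Odd (Fintype.card F))
    (g π : F[X]) (hπ : Irreducible π) (e : ℕ)
    (he : Odd e) (h1 : π ^ e ∣ g) (h2 : ¬ π ^ (e+1) ∣ g)
    (hg : 1 ≤ g.natDegree) (hM : 64 ≤ Fintype.card F)
    (hD : (g.natDegree + 2) ^ 2 ≤ Fintype.card F) :
    ((∑ x : F, quadraticChar F (g.eval x) : ℤ) : ℝ) ≤
      2 * (g.natDegree + 1) * Real.sqrt (Fintype.card F) := by
  have hF : ringChar F ≠ 2 := by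
    intro h
    have := FiniteField.even_card_of_char_two h
    obtain ⟨t, ht⟩ := hq
    omega
  have hcount := sp_count hq g π hπ e he h1 h2 hg hM hD
  have hg0 : g ≠ 0 := by rintro rfl; simp at hg
  have hpt : ∀ x : F, quadraticChar F (g.eval x) =
      2 * (if (g.eval x) ^ (Fintype.card F / 2) = 1 then 1 else 0) +
      (if g.eval x = 0 then 1 else 0) - 1 := by
    intro x
    by_cases h : g.eval x = 0
    · have : (0 : F) ^ (Fintype.card F / 2) = 0 := zero_pow (by omega)
      simp [h, this]
    · rw [quadraticChar_eq_pow_of_char_ne_two hF h]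
      split_ifs <;> simp
  have hN0 : (Finset.univ.filter fun x : F => g.eval x = 0).card ≤ g.natDegree := by
    refine le_trans (Finset.card_le_card ?_) ((Multiset.toFinset_card_le g.roots).trans (card_roots' g))
    intro x hx
    simpa [hg0] using hx
  have hN0' : ((Finset.univ.filter fun x : F => g.eval x = 0).card : ℝ) ≤ g.natDegree := by
    exact_mod_cast hN0
  have : (∑ x : F, quadraticChar F (g.eval x) : ℤ) =
      2 * (Finset.univ.filter fun x : F => (g.eval x) ^ (Fintype.card F / 2) = 1).card +
      (Finset.univ.filter fun x : F => g.eval x = 0).card - Fintype.card F := by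
    simp only [hpt]
    rw [Finset.sum_sub_distrib, Finset.sum_add_distrib, ← Finset.mul_sum, Finset.sum_boole,
      Finset.sum_boole]
    simp
  rw [this]
  push_cast
  linarith

theorem sp_sum_abs {F : Type} [Field F] [Fintype F] [DecidableEq F] (hq : Odd (Fintype.card F))
    (g π : F[X]) (hπ : Irreducible π) (e : ℕ)
    (he : Odd e) (h1 : π ^ e ∣ g) (h2 : ¬ π ^ (e+1) ∣ g)
    (hg : 1 ≤ g.natDegree) (hM : 64 ≤ Fintype.card F)
    (hD : (g.natDegree + 2) ^ 2 ≤ Fintype.card F) :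
    |((∑ x : F, quadraticChar F (g.eval x) : ℤ) : ℝ)| ≤
      2 * (g.natDegree + 1) * Real.sqrt (Fintype.card F) := by
  have hF : ringChar F ≠ 2 := by
    intro h
    have := FiniteField.even_card_of_char_two h
    obtain ⟨t, ht⟩ := hq
    omega
  refine abs_le.2 ⟨?_, sp_sum_le hq g π hπ e he h1 h2 hg hM hD⟩
  obtain ⟨c, hc⟩ := quadraticChar_exists_neg_one hF
  have hc0 : c ≠ 0 := by rintro rfl; simp at hc
  have hu : IsUnit (C c : F[X]) := isUnit_C.2 hc0.isUnit
  have hdeg : (C c * g).natDegree = g.natDegree := natDegree_C_mul hc0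
  have := sp_sum_le hq (C c * g) π hπ e he (h1.mul_left _) (by rwa [hu.dvd_mul_left])
    (by rwa [hdeg]) hM (by rwa [hdeg])
  rw [hdeg] at this
  simp only [eval_mul, eval_C, map_mul, hc, neg_mul, one_mul, Finset.sum_neg_distrib] at this
  push_cast at this ⊢
  linarith

theorem sp_iter_deg {F : Type} [Field F] (f : F[X]) (n : ℕ) :
    (polyIter f n).natDegree = f.natDegree ^ n := by
  induction n with
  | zero => simp [polyIter]
  | succ n ih => rw [polyIter, natDegree_comp, ih, pow_succ']

theorem sp_iter_eval {F : Type} [Field F] (f : F[X]) (n : ℕ) (x : F) :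
    (polyIter f n).eval x = f.eval^[n] x := by
  induction n with
  | zero => simp [polyIter]
  | succ n ih => rw [polyIter, eval_comp, ih, Function.iterate_succ_apply' (fun x => f.eval x)]

theorem sp_powerset_sum (w : ℕ → ℕ) (I : Finset ℕ) :
    2 * ∑ S ∈ I.powerset, ∑ i ∈ S, w i = 2 ^ I.card * ∑ i ∈ I, w i := by
  induction I using Finset.induction_on with
  | empty => simp
  | insert a I ha ih =>
    rw [Finset.sum_powerset_insert ha, Finset.sum_insert ha, Finset.card_insert_of_notMem ha]
    have : ∑ S ∈ I.powerset, ∑ i ∈ insert a S, w i = 2 ^ I.card * w a +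
        ∑ S ∈ I.powerset, ∑ i ∈ S, w i := by
      rw [← Finset.card_powerset, ← smul_eq_mul, ← Finset.sum_const, ← Finset.sum_add_distrib]
      refine Finset.sum_congr rfl fun S hS => ?_
      rw [Finset.sum_insert]
      intro h
      exact ha (Finset.mem_powerset.1 hS h)
    rw [this, pow_succ]
    linarith

theorem sp_geom (d L : ℕ) (hd : 2 ≤ d) : ∑ i ∈ Finset.Icc 1 L, d ^ i + 2 ≤ d ^ (L + 1) := by
  induction L with
  | zero => simpa using hd
  | succ n ih =>
    rw [Finset.sum_Icc_succ_top (by omega), pow_succ d (n+1)]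
    nlinarith [Nat.mul_le_mul_left (d ^ (n+1)) hd]

theorem sp_pattern {F : Type} [Field F] [Fintype F] [DecidableEq F] (hq : Odd (Fintype.card F))
    (f : F[X]) (hd : 2 ≤ f.natDegree) (hf : DynTwoOrdinary f) (L : ℕ)
    (hM : 64 ≤ Fintype.card F) (hD : (f.natDegree ^ (L + 1)) ^ 2 ≤ Fintype.card F)
    (ε : ℕ → ℤ) (hε : ∀ i ∈ Finset.Icc 1 L, ε i = 1 ∨ ε i = -1)
    (N : Finset F) (hN : ∀ x ∈ N, ∀ i ∈ Finset.Icc 1 L, quadraticChar F (f.eval^[i] x) = ε i) :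
    (N.card : ℝ) ≤ (Fintype.card F : ℝ) / 2 ^ L +
          (f.natDegree : ℝ) ^ (L + 1) * Real.sqrt (Fintype.card F) := by
  set I := Finset.Icc 1 L with hI
  set s := Real.sqrt (Fintype.card F) with hs
  set d := f.natDegree with hd'
  have hs0 : 0 ≤ s := Real.sqrt_nonneg _
  have hIc : I.card = L := by simp [hI]
  have hgeom := sp_geom d L hd
  rw [← hI] at hgeom
  -- lower bound
  have hlow : (2 : ℤ) ^ L * N.card ≤
      ∑ x : F, ∏ i ∈ I, (1 + ε i * quadraticChar F (f.eval^[i] x)) := by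
    have hnn : ∀ x : F, 0 ≤ ∏ i ∈ I, (1 + ε i * quadraticChar F (f.eval^[i] x)) := by
      intro x
      refine Finset.prod_nonneg fun i hi => ?_
      rcases hε i hi with h | h <;>
        rcases quadraticChar_isQuadratic F (f.eval^[i] x) with h2 | h2 | h2 <;> rw [h, h2] <;> norm_num
    calc _ = ∑ x ∈ N, (2 : ℤ) ^ L := by
            rw [Finset.sum_const, nsmul_eq_mul, mul_comm]
      _ ≤ ∑ x ∈ N,
            ∏ i ∈ I, (1 + ε i * quadraticChar F (f.eval^[i] x)) := by
          refine Finset.sum_le_sum fun x hx => le_of_eq ?_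
          have hx := hN x hx
          rw [← hIc, ← Finset.prod_const]
          refine Finset.prod_congr rfl fun i hi => ?_
          rw [hx i hi]
          rcases hε i hi with h | h <;> rw [h] <;> norm_num
      _ ≤ _ := Finset.sum_le_sum_of_subset_of_nonneg (Finset.subset_univ _) fun x _ _ => hnn x
  have hexp : ∑ x : F, ∏ i ∈ I, (1 + ε i * quadraticChar F (f.eval^[i] x)) =
      ∑ S ∈ I.powerset, (∏ i ∈ S, ε i) *
        ∑ x : F, quadraticChar F ((∏ i ∈ S, polyIter f i).eval x) := by
    simp only [Finset.prod_one_add]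
    rw [Finset.sum_comm]
    refine Finset.sum_congr rfl fun S _ => ?_
    rw [Finset.mul_sum]
    refine Finset.sum_congr rfl fun x _ => ?_
    rw [Finset.prod_mul_distrib, eval_prod, map_prod]
    simp only [sp_iter_eval]
  have hS : ∀ S ∈ I.powerset, (((∏ i ∈ S, ε i) *
        ∑ x : F, quadraticChar F ((∏ i ∈ S, polyIter f i).eval x) : ℤ) : ℝ) ≤
        (if S = ∅ then (Fintype.card F : ℝ) else 0) + 2 * (∑ i ∈ S, (d : ℝ) ^ i + 1) * s := by
    intro S hSI
    rw [Finset.mem_powerset] at hSI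
    split_ifs with hS0
    · subst hS0
      simp [hs0]
    have hne : S.Nonempty := Finset.nonempty_iff_ne_empty.2 hS0
    set n := S.max' hne with hn
    have hnS : n ∈ S := S.max'_mem hne
    have hn1 : 1 ≤ n := (Finset.mem_Icc.1 (hSI hnS)).1
    obtain ⟨π, hπ, ⟨e, he, h1, h2⟩, h3⟩ := hf n hn1
    have hprod : ∏ i ∈ S, polyIter f i = polyIter f n * ∏ i ∈ S.erase n, polyIter f i :=
      (Finset.mul_prod_erase _ _ hnS).symm
    have hrest : ¬ π ∣ ∏ i ∈ S.erase n, polyIter f i := by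
      rw [hπ.prime.dvd_finsetProd_iff]
      rintro ⟨i, hi, hdv⟩
      rw [Finset.mem_erase] at hi
      exact h3 i (lt_of_le_of_ne (S.le_max' i hi.2) hi.1) hdv
    have hne0 : ∀ i ∈ S, polyIter f i ≠ 0 := by
      intro i _ h0
      have := sp_iter_deg f i
      rw [h0, natDegree_zero] at this
      have : 0 < f.natDegree ^ i := by positivity
      omega
    have hdeg : (∏ i ∈ S, polyIter f i).natDegree = ∑ i ∈ S, d ^ i := by
      rw [natDegree_prod _ _ hne0]
      exact Finset.sum_congr rfl fun i _ => sp_iter_deg f i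
    have hdle : ∑ i ∈ S, d ^ i ≤ ∑ i ∈ I, d ^ i := Finset.sum_le_sum_of_subset hSI
    have hdge : d ^ n ≤ ∑ i ∈ S, d ^ i :=
      Finset.single_le_sum (f := fun i => d ^ i) (fun i _ => Nat.zero_le _) hnS
    have hdn : 1 ≤ d ^ n := Nat.one_le_pow _ _ (by omega)
    have hb := sp_sum_abs hq (∏ i ∈ S, polyIter f i) π hπ e he
      (by rw [hprod]; exact h1.mul_right _)
      (by rw [hprod]; exact fun h => h2 (hπ.prime.pow_dvd_of_dvd_mul_right _ hrest h))
      (by rw [hdeg]; omega) hM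
      (by rw [hdeg]; exact (Nat.pow_le_pow_left (by omega) 2).trans hD)
    rw [hdeg] at hb
    push_cast at hb ⊢
    rw [zero_add]
    refine (le_abs_self _).trans ?_
    rw [abs_mul]
    have he1 : |∏ i ∈ S, (ε i : ℝ)| = 1 := by
      rw [Finset.abs_prod]
      refine Finset.prod_eq_one fun i hi => ?_
      rcases hε i (hSI hi) with h | h <;> rw [h] <;> norm_num
    rw [he1, one_mul]
    exact hb
  have htot : (2 : ℝ) ^ L * (N.card : ℝ) ≤
      Fintype.card F + 2 ^ L * (d : ℝ) ^ (L + 1) * s := by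
    have c1 : (2 : ℝ) ^ L * (N.card : ℝ) ≤
      ((∑ S ∈ I.powerset, (∏ i ∈ S, ε i) *
        ∑ x : F, quadraticChar F ((∏ i ∈ S, polyIter f i).eval x) : ℤ) : ℝ) := by
      rw [← hexp]; exact_mod_cast hlow
    rw [Int.cast_sum] at c1
    refine (c1.trans (Finset.sum_le_sum hS)).trans ?_
    rw [Finset.sum_add_distrib, Finset.sum_ite_eq' , if_pos (Finset.empty_mem_powerset _),
      ← Finset.sum_mul, ← Finset.mul_sum, Finset.sum_add_distrib]
    simp only [Finset.sum_const, Finset.card_powerset, hIc, nsmul_eq_mul, mul_one]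
    have hp := sp_powerset_sum (fun i => d ^ i) I
    have hp' : 2 * ∑ S ∈ I.powerset, ∑ i ∈ S, (d : ℝ) ^ i = 2 ^ L * ∑ i ∈ I, (d : ℝ) ^ i := by
      rw [hIc] at hp; exact_mod_cast hp
    have hg' : ∑ i ∈ I, (d : ℝ) ^ i + 2 ≤ (d : ℝ) ^ (L + 1) := by exact_mod_cast hgeom
    have : (2 : ℝ) * (∑ S ∈ I.powerset, ∑ i ∈ S, (d : ℝ) ^ i + ((2 ^ L : ℕ) : ℝ)) ≤
        2 ^ L * (d : ℝ) ^ (L + 1) := by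
      rw [mul_add, hp', Nat.cast_pow]
      have := mul_le_mul_of_nonneg_left hg' (by positivity : (0:ℝ) ≤ 2 ^ L)
      push_cast
      linarith
    have := mul_le_mul_of_nonneg_right this hs0
    linarith
  have h2L : (0 : ℝ) < 2 ^ L := by positivity
  rw [← mul_le_mul_iff_right₀ h2L]
  refine htot.trans (le_of_eq ?_)
  field_simp

theorem sp_chi {F : Type} [Field F] [Fintype F] [DecidableEq F] (x : F) :
    chi x = quadraticChar F x := by
  unfold chi
  rw [quadraticChar_apply, quadraticCharFun]
  split_ifs <;> rfl

theorem sp_inj {F : Type} (φ : F → F) (a : F) (i j : ℕ)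
    (hij : i < j) (h : φ^[i] a = φ^[j] a) :
    (Set.range fun n : ℕ => φ^[n] a).ncard ≤ j := by
  classical
  have hsub : (Set.range fun n : ℕ => φ^[n] a) ⊆
      ((Finset.range j).image fun n => φ^[n] a : Finset F) := by
    rintro _ ⟨n, rfl⟩
    simp only [Finset.coe_image, Finset.coe_range, Set.mem_image, Set.mem_Iio]
    induction n using Nat.strong_induction_on with
    | _ n ih =>
      rcases Nat.lt_or_ge n j with hn | hn
      · exact ⟨n, hn, rfl⟩
      · obtain ⟨k, hk, hk2⟩ := ih (n - j + i) (by omega)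
        refine ⟨k, hk, hk2.trans ?_⟩
        rw [Function.iterate_add_apply, h, ← Function.iterate_add_apply]
        congr 1
        omega
  calc _ ≤ Set.ncard (((Finset.range j).image fun n => φ^[n] a : Finset F) : Set F) :=
        Set.ncard_le_ncard hsub (Finset.finite_toSet _)
    _ = ((Finset.range j).image fun n => φ^[n] a).card := Set.ncard_coe_finset _
    _ ≤ (Finset.range j).card := Finset.card_image_le
    _ = j := Finset.card_range j

theorem square_patterns_stmt17 {F : Type} [Field F] [Fintype F]
    (hq : Odd (Fintype.card F)) (f : F[X]) (hd : 2 ≤ f.natDegree)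
    (hf : DynTwoOrdinary f) (a : F) (m : ℕ)
    (hm : 0 < m ∧
      (∀ ℓ : ℕ, 1 ≤ ℓ → chi (f.eval^[ℓ + m] a) = chi (f.eval^[ℓ] a)) ∧
      (∀ m' : ℕ, 0 < m' →
        (∀ ℓ : ℕ, 1 ≤ ℓ → chi (f.eval^[ℓ + m'] a) = chi (f.eval^[ℓ] a)) → m ≤ m')) :
    ∀ L : ℕ, 1 ≤ L →
      (Set.ncard (Set.range fun n : ℕ => f.eval^[n] a) : ℝ) ≤
        2 * L + 1 + m * ((Fintype.card F : ℝ) / 2 ^ L +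
          (f.natDegree : ℝ) ^ (L + 1) * Real.sqrt (Fintype.card F)) := by
  classical
  intro L hL
  obtain ⟨hm0, hper, -⟩ := hm
  obtain ⟨T, hT⟩ : ∃ T, T = Set.ncard (Set.range fun n : ℕ => f.eval^[n] a) := ⟨_, rfl⟩
  obtain ⟨K, hK⟩ : ∃ K, K = (Fintype.card F : ℝ) / 2 ^ L +
          (f.natDegree : ℝ) ^ (L + 1) * Real.sqrt (Fintype.card F) := ⟨_, rfl⟩
  rw [← hT, ← hK]
  have hs2 : Real.sqrt (Fintype.card F) ^ 2 = (Fintype.card F : ℝ) := Real.sq_sqrt (Nat.cast_nonneg _)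
  have hd' : (2 : ℝ) ≤ f.natDegree := by exact_mod_cast hd
  have hq1 : (1 : ℝ) ≤ Fintype.card F := by exact_mod_cast Fintype.card_pos
  have hs1 : 1 ≤ Real.sqrt (Fintype.card F) := Real.one_le_sqrt.2 hq1
  have hdL : (1 : ℝ) ≤ (f.natDegree : ℝ) ^ (L + 1) := one_le_pow₀ (by linarith)
  have hK1 : 1 ≤ K := by
    have : (0 : ℝ) ≤ (Fintype.card F : ℝ) / 2 ^ L := by positivity
    nlinarith
  have hm1 : (1 : ℝ) ≤ m := by exact_mod_cast hm0
  have hL0 : (0 : ℝ) ≤ L := Nat.cast_nonneg _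
  rcases le_or_gt (Fintype.card F : ℝ) K with hcase | hcase
  · have hTq : T ≤ Fintype.card F := by
      rw [hT, ← Nat.card_eq_fintype_card, ← Set.ncard_univ]
      exact Set.ncard_le_ncard (Set.subset_univ _) Set.finite_univ
    have hTq' : (T : ℝ) ≤ Fintype.card F := by exact_mod_cast hTq
    nlinarith
  obtain ⟨s, hs⟩ : ∃ s, s = Real.sqrt (Fintype.card F) := ⟨_, rfl⟩
  rw [← hs] at hs2
  have hlt : (f.natDegree : ℝ) ^ (L + 1) < s ∧ 8 ≤ s := by
    rw [hK, ← hs, ← hs2] at hcase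
    rw [← hs] at hs1
    have h2L : (0 : ℝ) < 2 ^ L := by positivity
    have hs0 : 0 < s := by linarith
    have h1 : s / 2 ^ L + (f.natDegree : ℝ) ^ (L + 1) < s := by
      refine lt_of_mul_lt_mul_right ?_ hs0.le
      calc _ = s ^ 2 / 2 ^ L + (f.natDegree : ℝ) ^ (L + 1) * s := by ring
        _ < _ := hcase.trans_eq (sq s)
    have h2 : 0 < s / 2 ^ L := by positivity
    refine ⟨by linarith, ?_⟩
    have h3 : (2 : ℝ) ^ (L + 1) ≤ (f.natDegree : ℝ) ^ (L + 1) := pow_le_pow_left₀ (by norm_num) hd' _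
    rcases Nat.lt_or_ge L 2 with hL2 | hL2
    · obtain rfl : L = 1 := by omega
      norm_num at h1 h3
      linarith
    · have : (2 : ℝ) ^ 3 ≤ 2 ^ (L + 1) := pow_le_pow_right₀ (by norm_num) (by omega)
      norm_num at this
      linarith
  have hq64 : 64 ≤ Fintype.card F := by
    have : (64 : ℝ) ≤ Fintype.card F := by rw [← hs2]; nlinarith [hlt.2]
    exact_mod_cast this
  have hDq : (f.natDegree ^ (L + 1)) ^ 2 ≤ Fintype.card F := by
    have : ((f.natDegree : ℝ) ^ (L + 1)) ^ 2 ≤ Fintype.card F := by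
      rw [← hs2]; exact pow_le_pow_left₀ (by linarith) hlt.1.le 2
    exact_mod_cast this
  have hinj : ∀ i j, i < T → j < T → f.eval^[i] a = f.eval^[j] a → i = j := by
    intro i j hi hj h
    rcases lt_trichotomy i j with h' | h' | h'
    · have := sp_inj (fun x => f.eval x) a i j h' h
      omega
    · exact h'
    · have := sp_inj (fun x => f.eval x) a j i h' h.symm
      omega
  have hper' : ∀ t ℓ, 1 ≤ ℓ → chi (f.eval^[ℓ + m * t] a) = chi (f.eval^[ℓ] a) := by
    intro t
    induction t with
    | zero => intro ℓ _; simp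
    | succ t ih =>
      intro ℓ hℓ
      rw [mul_add, mul_one, ← add_assoc, hper _ (by omega), ih ℓ hℓ]
  have hpat : ∀ n i, 1 ≤ i → chi (f.eval^[n + i] a) = chi (f.eval^[n % m + i] a) := by
    intro n i hi
    have h : n + i = n % m + i + m * (n / m) := by
      have := Nat.mod_add_div n m
      omega
    exact (congrArg (fun t => chi (f.eval^[t] a)) h).trans (hper' _ _ (by omega))
  have hfib : ∀ r ∈ Finset.range m,
      (((Finset.range (T - L)).filter fun n => n % m = r).card : ℝ) ≤ K := by
    intro r _
    by_cases hz : ∀ i ∈ Finset.Icc 1 L, chi (f.eval^[r + i] a) ≠ 0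
    · have hpt := sp_pattern hq f hd hf L hq64 hDq (fun i => chi (f.eval^[r + i] a)) (by
        intro i hi
        have := hz i hi
        rw [sp_chi] at this ⊢
        rcases quadraticChar_isQuadratic F (f.eval^[r + i] a) with h | h | h
        · exact absurd h this
        · exact Or.inl h
        · exact Or.inr h)
        (((Finset.range (T - L)).filter fun n => n % m = r).image (fun n => f.eval^[n] a)) (by
        intro x hx i hi
        obtain ⟨n, hn, rfl⟩ := Finset.mem_image.1 hx
        have hn := Finset.mem_filter.1 hn
        show quadraticChar F (f.eval^[i] (f.eval^[n] a)) = chi (f.eval^[r + i] a)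
        rw [← sp_chi, ← Function.iterate_add_apply, add_comm i n,
          hpat n i (Finset.mem_Icc.1 hi).1, hn.2])
      rw [← hK] at hpt
      rw [Finset.card_image_of_injOn] at hpt
      · exact hpt
      · intro n hn n' hn' h
        have hn := (Finset.mem_filter.1 (Finset.mem_coe.1 hn)).1
        have hn' := (Finset.mem_filter.1 (Finset.mem_coe.1 hn')).1
        rw [Finset.mem_range] at hn hn'
        exact hinj n n' (by omega) (by omega) h
    · push Not at hz
      obtain ⟨i, hi, hi0⟩ := hz
      rw [Finset.mem_Icc] at hi
      have hzero : ∀ n, n % m = r → f.eval^[n + i] a = 0 := by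
        intro n hn
        have h1 := hpat n i hi.1
        rw [hn, hi0, sp_chi] at h1
        exact quadraticChar_eq_zero_iff.1 h1
      have : ((Finset.range (T - L)).filter fun n => n % m = r).card ≤ 1 := by
        rw [Finset.card_le_one]
        intro n hn n' hn'
        rw [Finset.mem_filter, Finset.mem_range] at hn hn'
        have := hinj (n + i) (n' + i) (by omega) (by omega)
          ((hzero n hn.2).trans (hzero n' hn'.2).symm)
        omega
      have h' : (((Finset.range (T - L)).filter fun n => n % m = r).card : ℝ) ≤ 1 := by
        exact_mod_cast this
      linarith
  have hcard : (Finset.range (T - L)).card = ∑ r ∈ Finset.range m,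
      ((Finset.range (T - L)).filter fun n => n % m = r).card :=
    Finset.card_eq_sum_card_fiberwise fun n _ => by
      simpa using Nat.mod_lt n hm0
  rw [Finset.card_range] at hcard
  have hTL : ((T - L : ℕ) : ℝ) ≤ m * K := by
    rw [hcard, Nat.cast_sum]
    refine (Finset.sum_le_sum hfib).trans ?_
    simp
  have hTT : (T : ℝ) ≤ L + ((T - L : ℕ) : ℝ) := by
    have : T ≤ L + (T - L) := by omega
    exact_mod_cast this
  linarith
end

section
/- Let q be an odd prime power, let f ∈ F_q[x] be a dynamically 2-ordinary polynomial of degree d ≥ 2, and let L be a positive integer. Then the number of elements x ∈ F_q such that f^ℓ(x) is a nonzero square in F_q for every ℓ ∈ {1,…,L} is at most q/2^L + d^{L+1}·√q. -/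
open Polynomial

lemma st_exists_aux {F : Type*} [Field F] (A M J l : ℕ) (c : ℕ → ℕ)
    (T1 T2 : ℕ → F[X] →ₗ[F] F[X]) (hJ : J ≤ M)
    (hsum : ∑ k ∈ Finset.range l, c k < (M + J) * A) :
    ∃ r s : ℕ → F[X], (∀ j, (r j).degree < A) ∧ (∀ j, (s j).degree < A) ∧
      (∀ j, J ≤ j → s j = 0) ∧ (∃ j, j < M ∧ (r j ≠ 0 ∨ s j ≠ 0)) ∧
      ∀ k, k < l → ∀ i, i < c k →
        (∑ j ∈ Finset.range M, (T1 k (r j) + T2 k (s j)) * X ^ j).coeff i = 0 := by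
  classical
  let V := (Fin M ⊕ Fin J) → degreeLT F A
  let R : ℕ → V →ₗ[F] F[X] := fun j =>
    if h : j < M then (degreeLT F A).subtype ∘ₗ LinearMap.proj (Sum.inl ⟨j, h⟩) else 0
  let S : ℕ → V →ₗ[F] F[X] := fun j =>
    if h : j < J then (degreeLT F A).subtype ∘ₗ LinearMap.proj (Sum.inr ⟨j, h⟩) else 0
  let Φ : V →ₗ[F] ((Σ k : Fin l, Fin (c k)) → F) := LinearMap.pi fun p =>
    lcoeff F (p.2 : ℕ) ∘ₗ ∑ j ∈ Finset.range M,
      (LinearMap.mulRight F (X ^ j : F[X])) ∘ₗ (T1 p.1 ∘ₗ R j + T2 p.1 ∘ₗ S j)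
  have : FiniteDimensional F (degreeLT F A) :=
    Module.Finite.equiv (degreeLTEquiv F A).symm
  have hfr : Module.finrank F (degreeLT F A) = A := by
    rw [(degreeLTEquiv F A).finrank_eq]; simp
  have hker : LinearMap.ker Φ ≠ ⊥ := by
    apply LinearMap.ker_ne_bot_of_finrank_lt
    rw [Module.finrank_fintype_fun_eq_card, Fintype.card_sigma]
    have : Module.finrank F V = (M + J) * A := by
      simp only [V]
      rw [Module.finrank_pi_fintype]
      simp [hfr]
    rw [this]
    simp only [Fintype.card_fin]
    rw [Fin.sum_univ_eq_sum_range (fun k => c k)]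
    exact hsum
  obtain ⟨v, hv, hv0⟩ := (Submodule.ne_bot_iff _).mp hker
  refine ⟨fun j => R j v, fun j => S j v, ?_, ?_, ?_, ?_, ?_⟩
  · intro j
    simp only [R]
    split_ifs with h
    · exact mem_degreeLT.1 (v (Sum.inl ⟨j, h⟩)).2
    · simp
  · intro j
    simp only [S]
    split_ifs with h
    · exact mem_degreeLT.1 (v (Sum.inr ⟨j, h⟩)).2
    · simp
  · intro j hj
    simp only [S]
    rw [dif_neg (by omega)]; simp
  · by_contra! hcon
    apply hv0
    funext x
    rcases x with x | x
    · have := (hcon x x.2).1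
      simp only [R] at this
      rw [dif_pos x.2] at this
      exact Subtype.ext this
    · have := (hcon x (by omega)).2
      simp only [S] at this
      rw [dif_pos x.2] at this
      exact Subtype.ext this
  · intro k hk i hi
    have h1 : Φ v = 0 := hv
    have h2 := congrFun h1 ⟨⟨k, hk⟩, ⟨i, hi⟩⟩
    simpa [Φ, LinearMap.sum_apply] using h2

section hasse
variable {F : Type*} [Field F]

lemma st_deg_hasse (f r : F[X]) (k : ℕ) (hm : 1 ≤ f.natDegree) :
    (f ^ k * hasseDeriv k r).natDegree ≤ r.natDegree + k * (f.natDegree - 1) := by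
  by_cases h : hasseDeriv k r = 0
  · simp [h]
  have hk : k ≤ r.natDegree := by
    by_contra hlt
    exact h (hasseDeriv_eq_zero_of_lt_natDegree _ _ (by omega))
  have h1 := natDegree_hasseDeriv_le r k
  have h2 : (f ^ k).natDegree ≤ k * f.natDegree := natDegree_pow_le
  have h3 := natDegree_mul_le (p := f ^ k) (q := hasseDeriv k r)
  obtain ⟨e, he⟩ : ∃ e, f.natDegree = e + 1 := ⟨f.natDegree - 1, by omega⟩
  rw [he] at h2 ⊢
  have : k * (e + 1) = k * e + k := by ring
  simp only [Nat.add_sub_cancel]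
  omega

lemma st_dvd (f : F[X]) (n j : ℕ) : f ^ n ∣ f ^ j * hasseDeriv j (f ^ n) := by
  induction n generalizing j with
  | zero => simp
  | succ n ih =>
    rw [pow_succ', hasseDeriv_mul, Finset.mul_sum]
    apply Finset.dvd_sum
    rintro ⟨a, b⟩ hab
    rw [Finset.HasAntidiagonal.mem_antidiagonal] at hab
    simp only at hab ⊢
    have : f ^ j * (hasseDeriv a f * hasseDeriv b (f ^ n)) =
      (f ^ a * hasseDeriv a f) * (f ^ b * hasseDeriv b (f ^ n)) := by
      rw [← hab]; ring
    rw [this]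
    apply mul_dvd_mul _ (ih b)
    rcases Nat.eq_zero_or_pos a with rfl | ha
    · simp
    · exact Dvd.dvd.mul_right (dvd_pow_self f (by omega)) _

/-- the quotient `f^j H_j(f^n) / f^n` -/
noncomputable def stU (f : F[X]) (n j : ℕ) : F[X] := (st_dvd f n j).choose

lemma stU_spec (f : F[X]) (n j : ℕ) : f ^ j * hasseDeriv j (f ^ n) = f ^ n * stU f n j :=
  (st_dvd f n j).choose_spec

lemma stU_deg (f : F[X]) (n j : ℕ) (hm : 1 ≤ f.natDegree) :
    (stU f n j).natDegree ≤ j * (f.natDegree - 1) := by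
  by_cases h : stU f n j = 0
  · simp [h]
  have hf : f ≠ 0 := by rintro rfl; simp at hm
  have h1 := st_deg_hasse f (f ^ n) j hm
  rw [stU_spec, natDegree_mul (pow_ne_zero _ hf) h] at h1
  omega

noncomputable def stT1 (f : F[X]) (k : ℕ) : F[X] →ₗ[F] F[X] :=
  LinearMap.mulLeft F (f ^ k) ∘ₗ hasseDeriv k

noncomputable def stT2 (f : F[X]) (n k : ℕ) : F[X] →ₗ[F] F[X] :=
  ∑ p ∈ Finset.HasAntidiagonal.antidiagonal k,
    LinearMap.mulRight F (stU f n p.2) ∘ₗ LinearMap.mulLeft F (f ^ p.1) ∘ₗ hasseDeriv p.1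

lemma stT1_apply (f : F[X]) (k : ℕ) (r : F[X]) : stT1 f k r = f ^ k * hasseDeriv k r := rfl

lemma stT2_apply (f : F[X]) (n k : ℕ) (s : F[X]) : stT2 f n k s =
    ∑ p ∈ Finset.HasAntidiagonal.antidiagonal k, f ^ p.1 * hasseDeriv p.1 s * stU f n p.2 := by
  simp [stT2, LinearMap.sum_apply]

lemma stT2_spec (f : F[X]) (n k : ℕ) (s : F[X]) :
    f ^ k * hasseDeriv k (s * f ^ n) = stT2 f n k s * f ^ n := by
  rw [hasseDeriv_mul, Finset.mul_sum, stT2_apply, Finset.sum_mul]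
  apply Finset.sum_congr rfl
  rintro ⟨a, b⟩ hab
  rw [Finset.HasAntidiagonal.mem_antidiagonal] at hab
  simp only at hab ⊢
  have h := stU_spec f n b
  rw [← hab, pow_add]
  calc _ = f ^ a * hasseDeriv a s * (f ^ b * hasseDeriv b (f ^ n)) := by ring
    _ = _ := by rw [h]; ring

lemma stT2_deg (f : F[X]) (n k : ℕ) (s : F[X]) (hm : 1 ≤ f.natDegree) :
    (stT2 f n k s).natDegree ≤ s.natDegree + k * (f.natDegree - 1) := by
  rw [stT2_apply]
  apply natDegree_sum_le_of_forall_le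
  rintro ⟨a, b⟩ hab
  rw [Finset.HasAntidiagonal.mem_antidiagonal] at hab
  simp only at hab ⊢
  have h1 := st_deg_hasse f s a hm
  have h2 := stU_deg f n b hm
  have h3 := natDegree_mul_le (p := f ^ a * hasseDeriv a s) (q := stU f n b)
  rw [← hab, add_mul]
  omega

lemma st_hasse_card [Fintype F] (k j : ℕ) (hk : k < Fintype.card F) (h : F[X]) :
    hasseDeriv k (X ^ (Fintype.card F * j) * h) = X ^ (Fintype.card F * j) * hasseDeriv k h := by
  have key : ∀ h : F[X], hasseDeriv k (X ^ Fintype.card F * h) =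
      X ^ Fintype.card F * hasseDeriv k h := by
    intro h
    rw [hasseDeriv_mul, Finset.sum_eq_single (0, k)]
    · simp
    · rintro ⟨a, b⟩ hab hne
      rw [Finset.HasAntidiagonal.mem_antidiagonal] at hab
      simp only at hab ⊢
      have ha : a ≠ 0 := by
        rintro rfl
        apply hne
        simp at hab
        simp [hab]
      obtain ⟨p, hp⟩ := CharP.exists F
      obtain ⟨n, hpp, hn⟩ := FiniteField.card F p
      rw [← monomial_one_right_eq_X_pow, hasseDeriv_monomial]
      have : ((Fintype.card F).choose a : F) = 0 := by
        rw [CharP.cast_eq_zero_iff F p]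
        rw [hn] at hk ⊢
        exact hpp.dvd_choose_pow ha (by omega)
      simp [this]
    · simp
  induction j with
  | zero => simp
  | succ j ih =>
    rw [Nat.mul_succ, pow_add, mul_comm (X ^ (Fintype.card F * j)), mul_assoc, key, ih]
    ring

end hasse

/-- `G` is not a constant times a square. -/
def StNS {F : Type*} [Field F] (G : F[X]) : Prop :=
  ∀ (r s : F[X]) (c : F), c ≠ 0 → r ^ 2 * G = C c * s ^ 2 → r = 0

section
variable {F : Type*} [Field F] [Fintype F]
set_option linter.unusedSectionVars false

lemma st_nonvanish (hq : Odd (Fintype.card F)) (G : F[X]) (hG : StNS G) (h0 : G.coeff 0 ≠ 0)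
    (A : ℕ) (hA : 2 * A + G.natDegree ≤ Fintype.card F + 1) (hm : 1 ≤ G.natDegree)
    (M : ℕ) (r s : ℕ → F[X]) (hr : ∀ j, (r j).degree < A) (hs : ∀ j, (s j).degree < A)
    (h : ∑ j ∈ Finset.range M, X ^ (Fintype.card F * j) *
      (r j + s j * G ^ (Fintype.card F / 2)) = 0) :
    ∀ j, j < M → r j = 0 ∧ s j = 0 := by
  induction M generalizing r s with
  | zero => intro j hj; omega
  | succ M ih =>
    set q := Fintype.card F with hqdef
    have hq0 : 0 < q := Fintype.card_pos
    have hn : 2 * (q / 2) + 1 = q := by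
      obtain ⟨t, ht⟩ := hq; omega
    rw [Finset.sum_range_succ'] at h
    have hrest : ∑ k ∈ Finset.range M, X ^ (q * (k + 1)) *
        (r (k + 1) + s (k + 1) * G ^ (q / 2)) =
        X ^ q * ∑ k ∈ Finset.range M, X ^ (q * k) *
        (r (k + 1) + s (k + 1) * G ^ (q / 2)) := by
      rw [Finset.mul_sum]
      apply Finset.sum_congr rfl
      intro k _
      rw [Nat.mul_succ, pow_add]; ring
    rw [hrest] at h
    set W := ∑ k ∈ Finset.range M, X ^ (q * k) * (r (k + 1) + s (k + 1) * G ^ (q / 2)) with hW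
    simp only [mul_zero, pow_zero, one_mul] at h
    have hexp : X ^ q ∣ G ^ q - C (G.coeff 0) := by
      rw [← FiniteField.expand_card G]
      rw [X_pow_dvd_iff]
      intro d hd
      rw [coeff_sub, coeff_expand hq0, coeff_C]
      by_cases hd0 : d = 0
      · subst hd0; simp
      · rw [if_neg, if_neg hd0, sub_zero]
        intro hdvd
        exact absurd (Nat.le_of_dvd (by omega) hdvd) (by omega)
    have hdvd : X ^ q ∣ (r 0) ^ 2 * G - C (G.coeff 0) * (s 0) ^ 2 := by
      have e1 : (r 0) ^ 2 * G - C (G.coeff 0) * (s 0) ^ 2 =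
          X ^ q * (- W * (r 0 - s 0 * G ^ (q / 2)) * G)
          + (G ^ q - C (G.coeff 0)) * (s 0) ^ 2 := by
        have hGq : G ^ q = (G ^ (q / 2)) ^ 2 * G := by
          rw [← pow_mul, ← pow_succ]; congr 1; omega
        rw [hGq]
        linear_combination (r 0 - s 0 * G ^ (q / 2)) * G * h
      rw [e1]
      exact dvd_add (dvd_mul_right _ _) (Dvd.dvd.mul_right hexp _)
    have hnat : ∀ p : F[X], p.degree < A → p = 0 ∨ p.natDegree + 1 ≤ A := by
      intro p hp
      by_cases h : p = 0
      · left; exact h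
      · right
        rw [degree_eq_natDegree h] at hp
        exact_mod_cast hp
    have hz : (r 0) ^ 2 * G - C (G.coeff 0) * (s 0) ^ 2 = 0 := by
      apply eq_zero_of_dvd_of_degree_lt hdvd
      rw [degree_X_pow]
      apply lt_of_le_of_lt (degree_sub_le _ _)
      apply max_lt
      · rcases hnat _ (hr 0) with h | h
        · rw [h]; simp
        · apply lt_of_le_of_lt degree_le_natDegree
          have h1 := natDegree_mul_le (p := (r 0) ^ 2) (q := G)
          have h2 := natDegree_pow_le (p := r 0) (n := 2)
          exact_mod_cast (by omega : ((r 0) ^ 2 * G).natDegree < q)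
      · rcases hnat _ (hs 0) with h | h
        · rw [h]; simp
        · apply lt_of_le_of_lt degree_le_natDegree
          have h1 := natDegree_C_mul_le (G.coeff 0) ((s 0) ^ 2)
          have h2 := natDegree_pow_le (p := s 0) (n := 2)
          exact_mod_cast (by omega : (C (G.coeff 0) * (s 0) ^ 2).natDegree < q)
    have hr0 : r 0 = 0 := hG _ _ _ h0 (sub_eq_zero.mp hz)
    have hs0 : s 0 = 0 := by
      rw [hr0] at hz
      simpa [h0] using hz
    rw [hr0, hs0] at h
    have hW0 : W = 0 := by
      simpa using h
    have := ih (fun j => r (j + 1)) (fun j => s (j + 1)) (fun j => hr _) (fun j => hs _) hW0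
    intro j hj
    rcases j with _ | j
    · exact ⟨hr0, hs0⟩
    · exact this j (by omega)

lemma st_count (P : F[X]) (hP : P ≠ 0) (l : ℕ) (S : Finset F)
    (h : ∀ x ∈ S, ∀ k, k < l → (hasseDeriv k P).eval x = 0) :
    S.card * l ≤ P.natDegree := by
  have hd : ∏ x ∈ S, (X - C x) ^ l ∣ P := by
    apply Finset.prod_dvd_of_coprime
    · intro x _ y _ hxy
      exact IsCoprime.pow (pairwise_coprime_X_sub_C (Function.injective_id) hxy)
    · intro x hx
      rw [X_sub_C_pow_dvd_iff, ← taylor_apply, X_pow_dvd_iff]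
      intro d hd
      rw [taylor_coeff]
      exact h x hx d hd
  have := natDegree_le_of_dvd hd hP
  rw [natDegree_prod_of_monic _ _ (fun x _ => (monic_X_sub_C x).pow l)] at this
  simpa [natDegree_pow] using this

lemma st_bound (hq : Odd (Fintype.card F)) (G : F[X]) (hG : StNS G) (h0 : G.coeff 0 ≠ 0)
    (A M K l : ℕ) (hA1 : 1 ≤ A) (hA : 2 * A + G.natDegree ≤ Fintype.card F + 1)
    (hm : 1 ≤ G.natDegree) (hK : G.natDegree ≤ 2 * K) (hKM : K + 1 ≤ M)
    (hl : l ≤ Fintype.card F)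
    (hcond : ∑ k ∈ Finset.range l, (A + M - 1 + k * (G.natDegree - 1)) < (M + (M - K)) * A)
    (S : Finset F) (hS : ∀ x ∈ S, G.eval x ^ (Fintype.card F / 2) = 1) :
    S.card * l ≤ (M - 1) * Fintype.card F + (A - 1) := by
  set q := Fintype.card F with hqdef
  set m := G.natDegree with hmdef
  have hq0 : 0 < q := Fintype.card_pos
  have hn : 2 * (q / 2) + 1 = q := by
    obtain ⟨t, ht⟩ := hq; omega
  obtain ⟨r, s, hr, hs, hsJ, hne, hc⟩ := st_exists_aux A M (M - K) l
    (fun k => A + M - 1 + k * (m - 1)) (stT1 G) (stT2 G (q / 2)) (by omega) hcond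
  have hnat : ∀ p : F[X], p.degree < A → p.natDegree ≤ A - 1 := by
    intro p hp
    by_cases h : p = 0
    · simp [h]
    · rw [degree_eq_natDegree h] at hp
      have : p.natDegree < A := by exact_mod_cast hp
      omega
  have hQ : ∀ k, k < l →
      ∑ j ∈ Finset.range M, (stT1 G k (r j) + stT2 G (q / 2) k (s j)) * X ^ j = 0 := by
    intro k hk
    ext i
    rw [coeff_zero]
    by_cases hi : i < A + M - 1 + k * (m - 1)
    · exact hc k hk i hi
    · apply coeff_eq_zero_of_natDegree_lt
      have : (∑ j ∈ Finset.range M, (stT1 G k (r j) + stT2 G (q / 2) k (s j)) * X ^ j).natDegree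
          ≤ (A - 1) + k * (m - 1) + (M - 1) := by
        apply natDegree_sum_le_of_forall_le
        intro j hj
        rw [Finset.mem_range] at hj
        have h1 := st_deg_hasse G (r j) k hm
        rw [← stT1_apply] at h1
        have h2 := stT2_deg G (q / 2) k (s j) hm
        rw [← hmdef] at h1 h2
        have h3 := natDegree_add_le (stT1 G k (r j)) (stT2 G (q / 2) k (s j))
        have h4 := natDegree_mul_le (p := stT1 G k (r j) + stT2 G (q / 2) k (s j))
          (q := (X : F[X]) ^ j)
        rw [natDegree_X_pow] at h4
        have h5 := hnat _ (hr j)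
        have h6 := hnat _ (hs j)
        have h7 : (stT1 G k (r j) + stT2 G (q / 2) k (s j)).natDegree ≤ (A - 1) + k * (m - 1) :=
          le_trans h3 (max_le (by omega) (by omega))
        omega
      omega
  set P : F[X] := ∑ j ∈ Finset.range M, X ^ (q * j) * (r j + s j * G ^ (q / 2)) with hP
  have hP0 : P ≠ 0 := by
    intro h
    obtain ⟨j, hj, hj'⟩ := hne
    have := st_nonvanish hq G hG h0 A hA hm M r s hr hs h j hj
    tauto
  have hPdeg : P.natDegree ≤ (M - 1) * q + (A - 1) := by
    apply natDegree_sum_le_of_forall_le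
    intro j hj
    rw [Finset.mem_range] at hj
    rw [mul_add]
    have hqj : ∀ j t, j + t ≤ M - 1 → q * j + t * q ≤ (M - 1) * q := by
      intro j t h
      calc q * j + t * q = (j + t) * q := by ring
        _ ≤ _ := Nat.mul_le_mul_right _ h
    apply natDegree_add_le_of_degree_le
    · have h4 := natDegree_mul_le (p := (X : F[X]) ^ (q * j)) (q := r j)
      rw [natDegree_X_pow] at h4
      have h5 := hnat _ (hr j)
      have := hqj j 0 (by omega)
      omega
    · by_cases hjJ : M - K ≤ j
      · rw [hsJ j hjJ]; simp
      · have h4 := natDegree_mul_le (p := (X : F[X]) ^ (q * j)) (q := s j * G ^ (q / 2))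
        rw [natDegree_X_pow] at h4
        have h5 := hnat _ (hs j)
        have h6 := natDegree_mul_le (p := s j) (q := G ^ (q / 2))
        have h7 := natDegree_pow_le (p := G) (n := q / 2)
        rw [← hmdef] at h7
        have := hqj j K (by omega)
        have h8 : q / 2 * m ≤ K * q := by
          calc q / 2 * m ≤ q / 2 * (2 * K) := Nat.mul_le_mul_left _ hK
            _ = (2 * (q / 2)) * K := by ring
            _ ≤ q * K := Nat.mul_le_mul_right _ (by omega)
            _ = K * q := by ring
        omega
  refine le_trans (st_count P hP0 l S ?_) hPdeg
  intro x hx k hk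
  have hGx : G.eval x ≠ 0 := by
    intro h
    have := hS x hx
    rw [h, zero_pow] at this
    · exact zero_ne_one this
    · omega
  have e1 : G ^ k * hasseDeriv k P = ∑ j ∈ Finset.range M,
      X ^ (q * j) * (stT1 G k (r j) + stT2 G (q / 2) k (s j) * G ^ (q / 2)) := by
    rw [hP, map_sum, Finset.mul_sum]
    apply Finset.sum_congr rfl
    intro j _
    rw [st_hasse_card k j (by omega), map_add, ← stT2_spec, stT1_apply]
    ring
  have e2 := congrArg (eval x) e1
  have e3 := congrArg (eval x) (hQ k hk)
  rw [eval_finsetSum] at e2 e3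
  have e4 : ∑ j ∈ Finset.range M, eval x
      (X ^ (q * j) * (stT1 G k (r j) + stT2 G (q / 2) k (s j) * G ^ (q / 2))) =
      ∑ j ∈ Finset.range M, eval x ((stT1 G k (r j) + stT2 G (q / 2) k (s j)) * X ^ j) := by
    apply Finset.sum_congr rfl
    intro j _
    simp only [eval_mul, eval_add, eval_pow, eval_X]
    rw [hS x hx, pow_mul, FiniteField.pow_card]
    ring
  rw [e4, e3] at e2
  simp only [eval_mul, eval_pow, eval_zero] at e2
  exact (mul_eq_zero.mp e2).resolve_left (pow_ne_zero _ hGx)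

end

lemma st_num_real (q m A K l M1 Z s : ℝ) (hs : s ^ 2 = q) (hs2 : 2 * (m + 1) ≤ s) (hm : 2 ≤ m)
    (hA1 : q - m ≤ 2 * A) (hA2 : 2 * A ≤ q - m + 1) (hK : 2 * K ≤ m + 1) (hl1 : l ≤ s)
    (hl2 : s ≤ l + 1) (hl6 : 6 ≤ l) (hM0 : 0 ≤ M1) (hZ : 2 * Z = (m - 1) * (l * (l - 1)))
    (hM : M1 * (2 * A - l) ≤ A * K + l * (A - 1) + Z) :
    2 * (M1 * q + (A - 1)) ≤ l * (q - m + 2 * (m + 1) * s) := by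
  have hs6 : 6 ≤ s := by linarith
  have hD : 3 / 4 * q ≤ 2 * A - l := by nlinarith
  have hq36 : 36 ≤ q := by nlinarith
  have hDpos : 0 < 2 * A - l := by linarith
  set D := 2 * A - l with hDdef
  -- 2 M1 ≤ l + K + m l^2 / D
  have h1 : (2 * M1 - l - K) * D ≤ m * l ^ 2 := by
    have : 2 * (A * K + l * (A - 1) + Z) = (l + K) * D + (K * l + m * l ^ 2 - (m + 1) * l) := by
      rw [hDdef]; linear_combination hZ
    nlinarith
  have h2 : (2 * M1 - l - K) * q ≤ 4 / 3 * (m * l ^ 2) := by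
    by_cases h : 2 * M1 - l - K ≤ 0
    · have : 0 ≤ m * l ^ 2 := by positivity
      nlinarith
    · push Not at h
      nlinarith
  have h3 : (K + 1) * q + 4 / 3 * (m * l ^ 2) ≤ l * (2 * (m + 1) * s - m) := by
    have a1 : (K + 1) * q ≤ (m + 3) / 2 * (7 / 6 * l * s) := by
      have : q ≤ 7 / 6 * l * s := by nlinarith
      have : (K + 1) * q ≤ (m + 3) / 2 * q := by nlinarith
      nlinarith
    have a2 : m * l ^ 2 ≤ m * (l * s) := by
      apply mul_le_mul_of_nonneg_left _ (by linarith)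
      nlinarith
    have a3 : 0 ≤ l * (s * (m / 12 + 1 / 4) - m) := by
      apply mul_nonneg (by linarith)
      nlinarith
    nlinarith
  nlinarith

set_option maxHeartbeats 1000000 in
lemma st_num (q m : ℕ) (hm : 2 ≤ m) (hq : 4 * (m + 1) ^ 2 < q) :
    ∃ A M K l : ℕ, 1 ≤ A ∧ 2 * A + m ≤ q + 1 ∧ m ≤ 2 * K ∧ K + 1 ≤ M ∧ 1 ≤ l ∧ l ≤ q ∧
      ∑ k ∈ Finset.range l, (A + M - 1 + k * (m - 1)) < (M + (M - K)) * A ∧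
      2 * (((M - 1) * q + (A - 1) : ℕ) : ℝ) ≤ l * ((q : ℝ) - m + 2 * (m + 1) * Real.sqrt q) := by
  set l := Nat.sqrt q with hl
  set A := (q - m + 1) / 2 with hA
  set K := (m + 1) / 2 with hK
  set Z := ∑ k ∈ Finset.range l, k * (m - 1) with hZ
  have hl2 : 2 * (m + 1) ≤ l := by
    rw [hl, Nat.le_sqrt]; nlinarith
  have hll : l * l ≤ q := Nat.sqrt_le q
  have hlu : q < (l + 1) * (l + 1) := Nat.lt_succ_sqrt q
  have hmq : 6 * m ≤ q := by nlinarith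
  have hlq : 6 * l ≤ q := by nlinarith
  have hDpos : 0 < 2 * A - l := by omega
  set D := 2 * A - l with hD
  have hDA : D + l = 2 * A := by omega
  obtain ⟨A', hA'⟩ : ∃ A', A = A' + 1 := ⟨A - 1, by omega⟩
  set R := A * K + l * (A - 1) + Z with hR
  set M1 := R / D with hM1
  have hMD : R < (M1 + 1) * D := by
    rw [hM1, mul_comm]; exact Nat.lt_mul_div_succ R hDpos
  have hMle : M1 * D ≤ R := Nat.div_mul_le_self R D
  have hKM : K ≤ M1 := by
    rw [hM1, Nat.le_div_iff_mul_le hDpos]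
    have h1 : K * D + K * l = 2 * (A * K) := by rw [← mul_add, hDA]; ring
    have h2 : A * K ≤ l * (A - 1) := by
      rw [hA', Nat.add_sub_cancel]
      have : K + 1 ≤ l := by omega
      have : K ≤ A' := by omega
      nlinarith
    omega
  have hZ2 : 2 * (Z : ℝ) = ((m : ℝ) - 1) * (l * ((l : ℝ) - 1)) := by
    have h1 : Z * 2 = l * (l - 1) * (m - 1) := by
      rw [hZ, ← Finset.sum_mul, mul_right_comm, Finset.sum_range_id_mul_two]
    have h2 : ((Z * 2 : ℕ) : ℝ) = ((l * (l - 1) * (m - 1) : ℕ) : ℝ) := by rw [h1]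
    push_cast [Nat.cast_sub (show 1 ≤ l by omega), Nat.cast_sub (show 1 ≤ m by omega)] at h2
    linear_combination h2
  clear_value M1 R D Z K A l
  refine ⟨A, M1 + 1, K, l, by omega, by omega, by omega, by omega, by omega, by omega, ?_, ?_⟩
  · rw [Finset.sum_add_distrib, ← hZ]
    simp only [Finset.sum_const, Finset.card_range, smul_eq_mul]
    obtain ⟨t, ht⟩ : ∃ t, M1 = K + t := ⟨M1 - K, by omega⟩
    have e1 : M1 + 1 - K = t + 1 := by omega
    have e2 : A + (M1 + 1) - 1 = (A - 1) + (M1 + 1) := by omega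
    rw [e1, e2]
    have e3 : (M1 + 1) * D + (M1 + 1) * l = 2 * (M1 + 1) * A := by
      rw [← mul_add, hDA]; ring
    have e4 : 2 * (M1 + 1) * A = (M1 + 1 + (t + 1)) * A + A * K := by rw [ht]; ring
    have e5 : l * ((A - 1) + (M1 + 1)) = l * (A - 1) + (M1 + 1) * l := by ring
    rw [e5]
    omega
  · have h := st_num_real q m A K l M1 Z (Real.sqrt q) (Real.sq_sqrt (Nat.cast_nonneg q))
      (by
        apply Real.le_sqrt_of_sq_le
        exact_mod_cast (by nlinarith : (2 * (m + 1)) ^ 2 ≤ q))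
      (by exact_mod_cast hm)
      (by
        have : q ≤ 2 * A + m := by omega
        have : (q : ℝ) ≤ 2 * A + m := by exact_mod_cast this
        linarith)
      (by
        have : 2 * A + m ≤ q + 1 := by omega
        have : 2 * (A : ℝ) + m ≤ q + 1 := by exact_mod_cast this
        linarith)
      (by exact_mod_cast (by omega : 2 * K ≤ m + 1))
      (by
        apply Real.le_sqrt_of_sq_le
        exact_mod_cast (by nlinarith : l ^ 2 ≤ q))
      (by
        rw [Real.sqrt_le_left (by positivity)]
        exact_mod_cast (by nlinarith : q ≤ (l + 1) ^ 2))
      (by exact_mod_cast (by omega : 6 ≤ l))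
      (by positivity) hZ2
      (by
        have e : ((M1 * D : ℕ) : ℝ) ≤ ((A * K + l * (A - 1) + Z : ℕ) : ℝ) := by
          rw [← hR]; exact_mod_cast hMle
        have hDr : (D : ℝ) = 2 * A - l := by
          have : (D : ℝ) + l = 2 * A := by exact_mod_cast hDA
          linarith
        push_cast [Nat.cast_sub (show 1 ≤ A by omega)] at e
        rw [hDr] at e
        exact e)
    have hA1 : 1 ≤ A := by omega
    rw [Nat.add_sub_cancel]
    push_cast [Nat.cast_sub hA1]
    exact h

section
variable {F : Type*} [Field F] [Fintype F] [DecidableEq F]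

lemma st_weil0 (hq : Odd (Fintype.card F)) (G : F[X]) (hG : StNS G) (h0 : G.coeff 0 ≠ 0)
    (hm : 2 ≤ G.natDegree) (hqm : 4 * (G.natDegree + 1) ^ 2 < Fintype.card F) :
    ((∑ x : F, quadraticChar F (G.eval x) : ℤ) : ℝ) ≤
      2 * (G.natDegree + 1) * Real.sqrt (Fintype.card F) := by
  have hchar : ringChar F ≠ 2 := by
    intro h
    have := FiniteField.even_card_iff_char_two.mp h
    obtain ⟨t, ht⟩ := hq
    omega
  obtain ⟨A, M, K, l, hA1, hA, hK, hKM, hl1, hl, hcond, hfin⟩ := st_num _ _ hm hqm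
  set S := Finset.univ.filter (fun x : F => quadraticChar F (G.eval x) = 1) with hS
  set S0 := Finset.univ.filter (fun x : F => G.eval x = 0) with hS0
  have hb := st_bound hq G hG h0 A M K l hA1 hA (by omega) hK hKM hl hcond S (by
    intro x hx
    rw [hS, Finset.mem_filter] at hx
    rw [← quadraticChar_eq_pow_of_char_ne_two' hchar, hx.2]
    simp)
  have hG0 : G ≠ 0 := by rintro rfl; simp at h0
  have hc0 : S0.card ≤ G.natDegree := by
    have : S0 ⊆ G.roots.toFinset := by
      intro x hx
      rw [hS0, Finset.mem_filter] at hx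
      simp [hG0, hx.2]
    exact (Finset.card_le_card this).trans ((Multiset.toFinset_card_le _).trans (card_roots' G))
  have hsum : ∑ x : F, quadraticChar F (G.eval x) =
      2 * (S.card : ℤ) + S0.card - Fintype.card F := by
    have : ∀ x : F, quadraticChar F (G.eval x) =
        2 * (if quadraticChar F (G.eval x) = 1 then 1 else 0)
          + (if G.eval x = 0 then 1 else 0) - 1 := by
      intro x
      by_cases h : G.eval x = 0
      · simp [h]
      · rcases quadraticChar_dichotomy h with h1 | h1 <;> rw [h1] <;> simp [h]
    rw [Finset.sum_congr rfl (fun x _ => this x)]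
    rw [Finset.sum_sub_distrib, Finset.sum_add_distrib, ← Finset.mul_sum]
    simp [hS, hS0, Finset.sum_boole]
  rw [hsum]
  push_cast
  have hlpos : (0 : ℝ) < l := by exact_mod_cast hl1
  have hb' : (S.card : ℝ) * l ≤ (((M - 1) * Fintype.card F + (A - 1) : ℕ) : ℝ) := by
    exact_mod_cast hb
  have hc0' : (S0.card : ℝ) ≤ G.natDegree := by exact_mod_cast hc0
  have : l * (2 * (S.card : ℝ)) ≤ l * ((Fintype.card F : ℝ) - G.natDegree
      + 2 * (G.natDegree + 1) * Real.sqrt (Fintype.card F)) := by linarith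
  have := le_of_mul_le_mul_left this hlpos
  linarith

lemma st_weil (hq : Odd (Fintype.card F)) (G : F[X]) (hG : StNS G) (hm : 2 ≤ G.natDegree) :
    ((∑ x : F, quadraticChar F (G.eval x) : ℤ) : ℝ) ≤
      2 * (G.natDegree + 1) * Real.sqrt (Fintype.card F) := by
  by_cases hqm : 4 * (G.natDegree + 1) ^ 2 < Fintype.card F
  · have hG0 : G ≠ 0 := by rintro rfl; simp at hm
    obtain ⟨a, ha⟩ : ∃ a : F, G.eval a ≠ 0 := by
      by_contra! hcon
      have : (Finset.univ : Finset F) ⊆ G.roots.toFinset := by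
        intro x _
        simp [hG0, hcon x]
      have := (Finset.card_le_card this).trans
        ((Multiset.toFinset_card_le _).trans (card_roots' G))
      rw [Finset.card_univ] at this
      nlinarith
    have hdeg : (G.comp (X + C a)).natDegree = G.natDegree := by
      rw [natDegree_comp, natDegree_X_add_C, mul_one]
    have hcc : ∀ p : F[X], (p.comp (X - C a)).comp (X + C a) = p := by
      intro p; rw [comp_assoc]; simp
    have hcc' : ∀ p : F[X], (p.comp (X + C a)).comp (X - C a) = p := by
      intro p; rw [comp_assoc]; simp
    have h := st_weil0 hq (G.comp (X + C a)) (by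
      intro r s c hc h
      have h' := congrArg (fun p => p.comp (X - C a)) h
      simp only [mul_comp, pow_comp, hcc', C_comp] at h'
      have := hG _ _ c hc h'
      rw [← hcc r, ← hcc' r]
      rw [hcc', this]; simp) (by
        rw [coeff_zero_eq_eval_zero, eval_comp]; simpa using ha) (by rw [hdeg]; exact hm)
        (by rw [hdeg]; exact hqm)
    rw [hdeg] at h
    have e : ∑ x : F, quadraticChar F ((G.comp (X + C a)).eval x) =
        ∑ x : F, quadraticChar F (G.eval x) := by
      rw [← Equiv.sum_comp (Equiv.addRight a) (fun x => quadraticChar F (G.eval x))]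
      apply Finset.sum_congr rfl
      intro x _
      simp [eval_comp]
    rw [e] at h
    exact h
  · push Not at hqm
    have h1 : ∑ x : F, quadraticChar F (G.eval x) ≤ ∑ x : F, 1 := by
      apply Finset.sum_le_sum
      intro x _
      by_cases h : G.eval x = 0
      · simp [h]
      · rcases quadraticChar_dichotomy h with h1 | h1 <;> rw [h1] <;> simp
    simp only [Finset.sum_const, Finset.card_univ, nsmul_eq_mul, mul_one] at h1
    have h2 : ((∑ x : F, quadraticChar F (G.eval x) : ℤ) : ℝ) ≤ Fintype.card F := by
      exact_mod_cast h1
    have h3 : Real.sqrt (Fintype.card F) ≤ 2 * (G.natDegree + 1) := by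
      rw [Real.sqrt_le_left (by positivity)]
      have : Fintype.card F ≤ (2 * (G.natDegree + 1)) ^ 2 := by nlinarith
      exact_mod_cast this
    have h4 : Real.sqrt (Fintype.card F) ^ 2 = Fintype.card F :=
      Real.sq_sqrt (Nat.cast_nonneg _)
    have h5 := Real.sqrt_nonneg (Fintype.card F : ℝ)
    nlinarith
end

lemma st_iter_eval {K : Type*} [CommRing K] (f : K[X]) (n : ℕ) (x : K) :
    f.eval^[n] x = (polyIter f n).eval x := by
  induction n with
  | zero => simp [polyIter]
  | succ n ih => rw [Function.iterate_succ_apply', ih, polyIter, eval_comp]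

lemma st_iter_deg {K : Type*} [Field K] (f : K[X]) (n : ℕ) :
    (polyIter f n).natDegree = f.natDegree ^ n := by
  induction n with
  | zero => simp [polyIter]
  | succ n ih => rw [polyIter, natDegree_comp, ih, pow_succ']

lemma st_ns_of_odd {K : Type*} [Field K] (G g : K[X]) (hg : Irreducible g) (e : ℕ) (he : Odd e)
    (h1 : emultiplicity g G = e) : StNS G := by
  intro r s c hc h
  by_contra hr
  have hp : Prime g := hg.prime
  have hG : G ≠ 0 := by
    rintro rfl
    simp at h1
  have hs : s ≠ 0 := by
    rintro rfl
    simp [hr, hG] at h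
  have hu : IsUnit (C c : K[X]) := isUnit_C.mpr (isUnit_iff_ne_zero.mpr hc)
  have hfr : FiniteMultiplicity g r := FiniteMultiplicity.of_prime_left hp hr
  have hfs : FiniteMultiplicity g s := FiniteMultiplicity.of_prime_left hp hs
  have h2 := congrArg (emultiplicity g) h
  rw [emultiplicity_mul hp, emultiplicity_mul hp, emultiplicity_pow hp, emultiplicity_pow hp, h1,
    hfr.emultiplicity_eq_multiplicity, hfs.emultiplicity_eq_multiplicity,
    emultiplicity_of_isUnit_right hg.not_isUnit hu] at h2
  have h3 : 2 * multiplicity g r + e = 0 + 2 * multiplicity g s := by exact_mod_cast h2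
  obtain ⟨t, ht⟩ := he
  omega

lemma st_ns_prod {K : Type*} [Field K] (f : K[X]) (hf : DynTwoOrdinary f) (T : Finset ℕ)
    (hT : T.Nonempty) (hT1 : ∀ i ∈ T, 1 ≤ i) : StNS (∏ i ∈ T, polyIter f i) := by
  set n := T.max' hT with hn
  have hnT : n ∈ T := T.max'_mem hT
  obtain ⟨g, hg, ⟨e, he, hd, hnd⟩, hlt⟩ := hf n (hT1 n hnT)
  apply st_ns_of_odd _ g hg e he
  rw [← Finset.mul_prod_erase _ _ hnT, emultiplicity_mul hg.prime,
    emultiplicity_eq_coe.mpr ⟨hd, hnd⟩]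
  rw [emultiplicity_eq_zero.mpr, add_zero]
  intro hdvd
  obtain ⟨i, hi, hi'⟩ := (hg.prime.dvd_finsetProd_iff _).mp hdvd
  refine hlt i ?_ hi'
  rw [Finset.mem_erase] at hi
  exact lt_of_le_of_ne (T.le_max' i hi.2) hi.1

lemma st_powerset_sum (T : Finset ℕ) (w : ℕ → ℝ) :
    2 * ∑ S ∈ T.powerset, ∑ i ∈ S, w i = 2 ^ T.card * ∑ i ∈ T, w i := by
  induction T using Finset.induction_on with
  | empty => simp
  | insert a T ha ih =>
    rw [Finset.sum_powerset_insert ha, Finset.card_insert_of_notMem ha, Finset.sum_insert ha]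
    have : ∑ S ∈ T.powerset, ∑ i ∈ insert a S, w i =
        ∑ S ∈ T.powerset, (w a + ∑ i ∈ S, w i) := by
      apply Finset.sum_congr rfl
      intro S hS
      rw [Finset.sum_insert (fun h => ha (Finset.mem_powerset.mp hS h))]
    rw [this, Finset.sum_add_distrib]
    simp only [Finset.sum_const, Finset.card_powerset, nsmul_eq_mul]
    push_cast
    rw [pow_succ]
    linear_combination 2 * ih

lemma st_geom (d : ℝ) (hd : 2 ≤ d) (L : ℕ) (hL : 1 ≤ L) :
    ∑ i ∈ Finset.Icc 1 L, d ^ i + 2 ≤ d ^ (L + 1) := by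
  induction L, hL using Nat.le_induction with
  | base => simp; nlinarith
  | succ n hn ih =>
    rw [Finset.sum_Icc_succ_top (by omega), pow_succ d (n + 1)]
    have : 0 ≤ d ^ (n + 1) := by positivity
    nlinarith

theorem square_patterns_stmt18 {F : Type} [Field F] [Fintype F]
    (hq : Odd (Fintype.card F)) (f : F[X]) (hd : 2 ≤ f.natDegree)
    (hf : DynTwoOrdinary f) (L : ℕ) (hL : 1 ≤ L) :
    (Set.ncard {x : F | ∀ ℓ : ℕ, 1 ≤ ℓ → ℓ ≤ L →
        f.eval^[ℓ] x ≠ 0 ∧ IsSquare (f.eval^[ℓ] x)} : ℝ) ≤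
      (Fintype.card F : ℝ) / 2 ^ L +
        (f.natDegree : ℝ) ^ (L + 1) * Real.sqrt (Fintype.card F) := by
  classical
  set s := Real.sqrt (Fintype.card F) with hs
  have hs0 : 0 ≤ s := Real.sqrt_nonneg _
  set I := Finset.Icc 1 L with hI
  set d : ℝ := (f.natDegree : ℝ) with hdd
  have hd' : (2 : ℝ) ≤ d := by rw [hdd]; exact_mod_cast hd
  let N := Finset.univ.filter (fun x : F => ∀ ℓ : ℕ, 1 ≤ ℓ → ℓ ≤ L →
        f.eval^[ℓ] x ≠ 0 ∧ IsSquare (f.eval^[ℓ] x))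
  have hN : Set.ncard {x : F | ∀ ℓ : ℕ, 1 ≤ ℓ → ℓ ≤ L →
        f.eval^[ℓ] x ≠ 0 ∧ IsSquare (f.eval^[ℓ] x)} = N.card := by
    rw [← Set.ncard_coe_finset]
    congr 1
    ext x
    simp [N]
  rw [hN]
  have h1 : (N.card : ℤ) * 2 ^ L ≤
      ∑ x : F, ∏ i ∈ I, (1 + quadraticChar F ((polyIter f i).eval x)) := by
    have hnn : ∀ x : F, ∀ i, 0 ≤ 1 + quadraticChar F ((polyIter f i).eval x) := by
      intro x i
      by_cases h : (polyIter f i).eval x = 0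
      · simp [h]
      · rcases quadraticChar_dichotomy h with h1 | h1
        · rw [h1]; norm_num
        · rw [h1]; norm_num
    have : ∑ x ∈ N, ∏ i ∈ I, (1 + quadraticChar F ((polyIter f i).eval x)) ≤
        ∑ x : F, ∏ i ∈ I, (1 + quadraticChar F ((polyIter f i).eval x)) := by
      apply Finset.sum_le_sum_of_subset_of_nonneg (Finset.subset_univ _)
      intro x _ _
      exact Finset.prod_nonneg (fun i _ => hnn x i)
    refine le_trans (le_of_eq ?_) this
    rw [Finset.sum_congr rfl (g := fun _ => (2 : ℤ) ^ L)]
    · simp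
    · intro x hx
      simp only [N, Finset.mem_filter, Finset.mem_univ, true_and] at hx
      rw [Finset.prod_congr rfl (g := fun _ => (2 : ℤ))]
      · simp [hI]
      · intro i hi
        rw [hI, Finset.mem_Icc] at hi
        have := hx i hi.1 hi.2
        rw [st_iter_eval] at this
        rw [(quadraticChar_one_iff_isSquare this.1).mpr this.2]
        norm_num
  have h2 : ∑ x : F, ∏ i ∈ I, (1 + quadraticChar F ((polyIter f i).eval x)) =
      ∑ T ∈ I.powerset, ∑ x : F, quadraticChar F ((∏ i ∈ T, polyIter f i).eval x) := by
    rw [Finset.sum_comm]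
    apply Finset.sum_congr rfl
    intro x _
    rw [Finset.prod_one_add]
    apply Finset.sum_congr rfl
    intro T _
    rw [eval_prod, map_prod]
  have h3 : ∀ T ∈ I.powerset,
      ((∑ x : F, quadraticChar F ((∏ i ∈ T, polyIter f i).eval x) : ℤ) : ℝ) ≤
      (if T = ∅ then (Fintype.card F : ℝ) else 0) + 2 * s * ∑ i ∈ T, d ^ i + 2 * s := by
    intro T hT
    rw [Finset.mem_powerset] at hT
    by_cases hTe : T = ∅
    · subst hTe
      simp
      exact hs0
    · have hTn : T.Nonempty := Finset.nonempty_iff_ne_empty.mpr hTe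
      have hT1 : ∀ i ∈ T, 1 ≤ i := fun i hi => (Finset.mem_Icc.mp (hT hi)).1
      have hf0 : ∀ i ∈ T, polyIter f i ≠ 0 := by
        intro i _ h
        have := st_iter_deg f i
        rw [h, natDegree_zero] at this
        have : 0 < f.natDegree ^ i := by positivity
        omega
      have hdeg : (∏ i ∈ T, polyIter f i).natDegree = ∑ i ∈ T, f.natDegree ^ i := by
        rw [natDegree_prod _ _ hf0]
        exact Finset.sum_congr rfl (fun i _ => st_iter_deg f i)
      have hdeg2 : 2 ≤ (∏ i ∈ T, polyIter f i).natDegree := by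
        rw [hdeg]
        obtain ⟨i, hi⟩ := hTn
        calc 2 ≤ f.natDegree ^ 1 := by simpa using hd
          _ ≤ f.natDegree ^ i := Nat.pow_le_pow_right (by omega) (hT1 i hi)
          _ ≤ _ := Finset.single_le_sum (f := fun i => f.natDegree ^ i)
            (fun _ _ => Nat.zero_le _) hi
      have := st_weil hq _ (st_ns_prod f hf T hTn hT1) hdeg2
      rw [hdeg] at this
      push_cast at this
      push_cast
      rw [if_neg hTe]
      rw [← hs, ← hdd] at this
      linarith
  have h4 : ((N.card : ℝ)) * 2 ^ L ≤ ∑ T ∈ I.powerset,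
      ((if T = ∅ then (Fintype.card F : ℝ) else 0) + 2 * s * ∑ i ∈ T, d ^ i + 2 * s) := by
    refine le_trans ?_ (Finset.sum_le_sum h3)
    rw [h2] at h1
    exact_mod_cast h1
  have hIc : I.card = L := by simp [hI]
  have h5 : ∑ T ∈ I.powerset,
      ((if T = ∅ then (Fintype.card F : ℝ) else 0) + 2 * s * ∑ i ∈ T, d ^ i + 2 * s) =
      Fintype.card F + 2 ^ L * (s * (∑ i ∈ I, d ^ i + 2)) := by
    rw [Finset.sum_add_distrib, Finset.sum_add_distrib, ← Finset.mul_sum]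
    have := st_powerset_sum I (fun i => d ^ i)
    rw [hIc] at this
    have e : ∑ T ∈ I.powerset, (if T = ∅ then (Fintype.card F : ℝ) else 0) = Fintype.card F := by
      rw [Finset.sum_ite_eq']
      simp
    rw [e]
    simp only [Finset.sum_const, Finset.card_powerset, nsmul_eq_mul, hIc]
    push_cast
    linear_combination s * this
  rw [h5] at h4
  have h6 := st_geom d hd' L hL
  have h7 : (N.card : ℝ) * 2 ^ L ≤ Fintype.card F + 2 ^ L * (s * d ^ (L + 1)) := by
    refine le_trans h4 ?_
    gcongr
  have h8 : (0 : ℝ) < 2 ^ L := by positivity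
  have : (Fintype.card F : ℝ) / 2 ^ L + d ^ (L + 1) * s =
      (Fintype.card F + 2 ^ L * (s * d ^ (L + 1))) / 2 ^ L := by
    field_simp
  rw [this, le_div_iff₀ h8]
  exact h7
end
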